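/- arXiv:1211.4007 — 5 statements merged into one kernel-verified Lean document; each statement's English description precedes it below -/
import Mathlib

section
/- Let k≥1 and let F₁,F₂:(0,∞)→ℝ be k-times differentiable functions, both integrable on (0,∞), such that for i=1,2, every 0≤l≤k and every c>0, the l-th derivative of Fᵢ is uniformly continuous on [c,∞). Then there exist real constants w̄₀,…,w̄_{k−1} (depending only on k) such that for every x>0: (F₁*F₂)^{(k)}(x) = ∫₀^{x/2} F₁(y)·F₂^{(k)}(x−y) dy + ∫₀^{x/2} F₂(y)·F₁^{(k)}(x−y) dy + ∑_{l=0}^{k−1} w̄_l·F₁^{(l)}(x/2)·F₂^{(k−1−l)}(x/2). Moreover, for every z₀>0 and every x>z₀: (F₁*F₂)^{(k)}(x) = ∫₀^{z₀} F₁(y)·F₂^{(k)}(x−y) dy + ∫₀^{x−z₀} F₂(y)·F₁^{(k)}(x−y) dy + ∑_{l=0}^{k−1} F₁^{(l)}(z₀)·F₂^{(k−1−l)}(x−z₀). -/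
open MeasureTheory Set Filter Topology

lemma intervalIntegrable_mul_comp_sub_left {f E : ℝ → ℝ} (hf : IntegrableOn f (Ioi 0))
    (hE : ContinuousOn E (Ioi 0)) {z x : ℝ} (hz : 0 ≤ z) (hzx : z < x) :
    IntervalIntegrable (fun y => f y * E (x - y)) volume 0 z := by
  refine IntervalIntegrable.mul_continuousOn ?_ ?_
  · rw [intervalIntegrable_iff_integrableOn_Ioc_of_le hz]
    exact hf.mono_set Ioc_subset_Ioi_self
  · refine hE.comp (by fun_prop) fun y hy => ?_
    rw [uIcc_of_le hz] at hy
    exact sub_pos.2 (hy.2.trans_lt hzx)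

lemma hasDerivAt_intervalIntegral_mul_comp_sub_left {f E E' : ℝ → ℝ}
    (hf : IntegrableOn f (Ioi 0)) (hE : ∀ x > (0 : ℝ), HasDerivAt E (E' x) x)
    (hE' : ContinuousOn E' (Ioi 0)) {z x₀ : ℝ} (hz : 0 ≤ z) (hzx : z < x₀) :
    HasDerivAt (fun x => ∫ y in (0 : ℝ)..z, f y * E (x - y))
      (∫ y in (0 : ℝ)..z, f y * E' (x₀ - y)) x₀ := by
  have hEc : ContinuousOn E (Ioi 0) := fun x hx => (hE x hx).continuousAt.continuousWithinAt
  set δ := (x₀ - z) / 2 with hδ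
  have hδ0 : 0 < δ := by rw [hδ]; linarith
  obtain ⟨M, hM⟩ := (isCompact_Icc (a := δ) (b := x₀ + δ)).exists_bound_of_continuousOn
    (hE'.mono fun y hy => hδ0.trans_le hy.1)
  have hmem : ∀ y ∈ Ioc 0 z, ∀ x ∈ Metric.ball x₀ δ, x - y ∈ Icc δ (x₀ + δ) := by
    intro y hy x hx
    rw [Real.ball_eq_Ioo] at hx
    constructor <;> linarith [hx.1, hx.2, hy.1, hy.2]
  refine (intervalIntegral.hasDerivAt_integral_of_dominated_loc_of_deriv_le
    (F := fun x y => f y * E (x - y)) (F' := fun x y => f y * E' (x - y))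
    (bound := fun y => ‖f y‖ * M) (Metric.ball_mem_nhds x₀ hδ0) ?_
    (intervalIntegrable_mul_comp_sub_left hf hEc hz hzx)
    (intervalIntegrable_mul_comp_sub_left hf hE' hz hzx).aestronglyMeasurable_restrict_uIoc
    ?_ ?_ ?_).2
  · filter_upwards [lt_mem_nhds hzx] with x hx using
      (intervalIntegrable_mul_comp_sub_left hf hEc hz hx).aestronglyMeasurable_restrict_uIoc
  · refine Eventually.of_forall fun y hy x hx => ?_
    rw [uIoc_of_le hz] at hy
    rw [norm_mul]
    exact mul_le_mul_of_nonneg_left (hM _ (hmem y hy x hx)) (norm_nonneg _)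
  · refine IntervalIntegrable.mul_const ?_ _
    refine IntervalIntegrable.norm ?_
    rw [intervalIntegrable_iff_integrableOn_Ioc_of_le hz]
    exact hf.mono_set Ioc_subset_Ioi_self
  · refine Eventually.of_forall fun y hy x hx => ?_
    rw [uIoc_of_le hz] at hy
    exact ((hE _ (hδ0.trans_le (hmem y hy x hx).1)).comp_sub_const x y).const_mul _

lemma hasDerivAt_intervalIntegral_mul_comp_sub_right {f E : ℝ → ℝ} {z x₀ : ℝ}
    (hf : ContinuousAt f (x₀ - z)) (hE : ContinuousAt E z) :
    HasDerivAt (fun x => ∫ y in (x₀ - z)..(x - z), f y * E (x - y) - f (x₀ - z) * E z) 0 x₀ := by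
  have hc : ContinuousAt (fun p : ℝ × ℝ => f p.1 * E p.2) (x₀ - z, z) :=
    (ContinuousAt.comp (g := f) (f := Prod.fst) hf continuousAt_fst).mul
      (ContinuousAt.comp (g := E) (f := Prod.snd) hE continuousAt_snd)
  rw [hasDerivAt_iff_isLittleO, Asymptotics.isLittleO_iff]
  intro ε hε
  obtain ⟨δ, hδ, h⟩ := Metric.continuousAt_iff.1 hc ε hε
  filter_upwards [Metric.ball_mem_nhds x₀ hδ] with x hx
  simp only [intervalIntegral.integral_same, sub_zero, smul_zero]
  refine (intervalIntegral.norm_integral_le_of_norm_le_const (C := ε) fun y hy => ?_).trans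
    (by rw [Real.norm_eq_abs]; simp)
  rw [← dist_eq_norm]
  refine (h (x := (y, x - y)) ?_).le
  rw [Metric.mem_ball, Real.dist_eq, abs_lt] at hx
  rw [Prod.dist_eq, max_lt_iff, Real.dist_eq, Real.dist_eq, abs_lt, abs_lt]
  rcases mem_uIoc.1 hy with hy | hy <;>
    refine ⟨⟨?_, ?_⟩, ?_, ?_⟩ <;> dsimp only <;> linarith [hx.1, hx.2, hy.1, hy.2]

lemma hasDerivAt_intervalIntegral_mul_comp_sub {f E E' : ℝ → ℝ}
    (hf : IntegrableOn f (Ioi 0)) (hfc : ContinuousOn f (Ioi 0))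
    (hE : ∀ x > (0 : ℝ), HasDerivAt E (E' x) x)
    (hE' : ContinuousOn E' (Ioi 0)) {z x₀ : ℝ} (hz : 0 < z) (hzx : z < x₀) :
    HasDerivAt (fun x => ∫ y in (0 : ℝ)..(x - z), f y * E (x - y))
      ((∫ y in (0 : ℝ)..(x₀ - z), f y * E' (x₀ - y)) + f (x₀ - z) * E z) x₀ := by
  have hEc : ContinuousOn E (Ioi 0) := fun x hx => (hE x hx).continuousAt.continuousWithinAt
  have hs : 0 < x₀ - z := sub_pos.2 hzx
  have h1 := hasDerivAt_intervalIntegral_mul_comp_sub_left hf hE hE' hs.le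
    (show x₀ - z < x₀ by linarith)
  have h2 := hasDerivAt_intervalIntegral_mul_comp_sub_right
    (hfc.continuousAt (Ioi_mem_nhds hs)) (hEc.continuousAt (Ioi_mem_nhds hz))
  have h3 : HasDerivAt (fun x => (x - x₀) * (f (x₀ - z) * E z)) (f (x₀ - z) * E z) x₀ := by
    simpa using ((hasDerivAt_id x₀).sub_const x₀).mul_const (f (x₀ - z) * E z)
  have h4 := (h1.add h2).add h3
  rw [add_zero] at h4
  refine h4.congr_of_eventuallyEq ?_
  filter_upwards [lt_mem_nhds hzx, lt_mem_nhds (show x₀ - z < x₀ by linarith)] with x hx hx'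
  have i1 := intervalIntegrable_mul_comp_sub_left hf hEc hs.le hx'
  have i2 := intervalIntegrable_mul_comp_sub_left hf hEc (sub_pos.2 hx).le
    (show x - z < x by linarith)
  have i3 := i1.symm.trans i2
  simp only [Pi.add_apply]
  rw [intervalIntegral.integral_sub i3 intervalIntegrable_const,
    ← intervalIntegral.integral_add_adjacent_intervals i1 i3, intervalIntegral.integral_const]
  simp only [smul_eq_mul]
  ring

lemma integral_mul_comp_sub_eq_add {F₁ F₂ : ℝ → ℝ} (h₁ : ∀ x ≤ (0 : ℝ), F₁ x = 0)
    (h₂ : ∀ x ≤ (0 : ℝ), F₂ x = 0) (hi₁ : IntegrableOn F₁ (Ioi 0))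
    (hi₂ : IntegrableOn F₂ (Ioi 0)) (hc₁ : ContinuousOn F₁ (Ioi 0))
    (hc₂ : ContinuousOn F₂ (Ioi 0)) {z x : ℝ} (hz : 0 < z) (hzx : z < x) :
    ∫ y, F₁ y * F₂ (x - y) =
      (∫ y in (0 : ℝ)..z, F₁ y * F₂ (x - y)) +
        ∫ y in (0 : ℝ)..(x - z), F₂ y * F₁ (x - y) := by
  have i1 := intervalIntegrable_mul_comp_sub_left hi₁ hc₂ hz.le hzx
  have i2 : IntervalIntegrable (fun y => F₁ y * F₂ (x - y)) volume z x := by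
    have := (intervalIntegrable_mul_comp_sub_left hi₂ hc₁ (sub_pos.2 hzx).le
      (show x - z < x by linarith)).comp_sub_left x
    simp only [sub_sub_cancel, sub_zero] at this
    exact by simpa only [mul_comm] using this.symm
  have e : ∫ y in (0 : ℝ)..(x - z), F₂ y * F₁ (x - y) = ∫ y in z..x, F₁ y * F₂ (x - y) := by
    have := intervalIntegral.integral_comp_sub_left
      (a := 0) (b := x - z) (fun y => F₁ y * F₂ (x - y)) x
    simp only [sub_sub_cancel, sub_zero] at this
    rw [← this]
    simp only [mul_comm]
  rw [e, intervalIntegral.integral_add_adjacent_intervals i1 i2,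
    intervalIntegral.integral_of_le (hz.trans hzx).le]
  refine (setIntegral_eq_integral_of_forall_compl_eq_zero fun y hy => ?_).symm
  rcases le_or_gt y 0 with h | h
  · rw [h₁ y h, zero_mul]
  · have : x < y := not_le.1 fun h' => hy ⟨h, h'⟩
    rw [h₂ _ (by linarith), mul_zero]

/-- The convolution of two functions with iterated derivatives `D₁`, `D₂`, differentiated `j` times
under the integral sign after splitting the domain of integration at `z`. -/
noncomputable def splitConvDeriv (D₁ D₂ : ℕ → ℝ → ℝ) (z : ℝ) (j : ℕ) (x : ℝ) : ℝ :=
  (∫ y in (0 : ℝ)..z, D₁ 0 y * D₂ j (x - y)) +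
    (∫ y in (0 : ℝ)..(x - z), D₂ 0 y * D₁ j (x - y)) +
    ∑ l ∈ Finset.range j, D₁ l z * D₂ (j - 1 - l) (x - z)

lemma hasDerivAt_splitConvDeriv {D₁ D₂ : ℕ → ℝ → ℝ} {k j : ℕ}
    (hi₁ : IntegrableOn (D₁ 0) (Ioi 0)) (hi₂ : IntegrableOn (D₂ 0) (Ioi 0))
    (hd₁ : ∀ l < k, ∀ x > (0 : ℝ), HasDerivAt (D₁ l) (D₁ (l + 1) x) x)
    (hd₂ : ∀ l < k, ∀ x > (0 : ℝ), HasDerivAt (D₂ l) (D₂ (l + 1) x) x)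
    (hc₁ : ∀ l ≤ k, ContinuousOn (D₁ l) (Ioi 0))
    (hc₂ : ∀ l ≤ k, ContinuousOn (D₂ l) (Ioi 0)) (hj : j < k) {z x : ℝ} (hz : 0 < z)
    (hzx : z < x) :
    HasDerivAt (splitConvDeriv D₁ D₂ z j) (splitConvDeriv D₁ D₂ z (j + 1) x) x := by
  have h1 := hasDerivAt_intervalIntegral_mul_comp_sub_left hi₁ (hd₂ j hj) (hc₂ _ hj) hz.le hzx
  have h2 := hasDerivAt_intervalIntegral_mul_comp_sub hi₂ (hc₂ 0 (Nat.zero_le _)) (hd₁ j hj)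
    (hc₁ _ hj) hz hzx
  have h3 : HasDerivAt (fun x => ∑ l ∈ Finset.range j, D₁ l z * D₂ (j - 1 - l) (x - z))
      (∑ l ∈ Finset.range j, D₁ l z * D₂ (j - l) (x - z)) x := by
    refine HasDerivAt.fun_sum fun l hl => ?_
    have hl := Finset.mem_range.1 hl
    have := ((hd₂ (j - 1 - l) (by omega) (x - z) (sub_pos.2 hzx)).comp_sub_const x z).const_mul
      (D₁ l z)
    rwa [show j - 1 - l + 1 = j - l by omega] at this
  refine ((h1.add h2).add h3).congr_deriv ?_
  rw [splitConvDeriv, Finset.sum_range_succ]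
  simp only [Nat.add_sub_cancel, Nat.sub_self]
  ring

lemma splitConvDeriv_eq {D₁ D₂ : ℕ → ℝ → ℝ} {k : ℕ}
    (h₁ : ∀ x ≤ (0 : ℝ), D₁ 0 x = 0) (h₂ : ∀ x ≤ (0 : ℝ), D₂ 0 x = 0)
    (hi₁ : IntegrableOn (D₁ 0) (Ioi 0)) (hi₂ : IntegrableOn (D₂ 0) (Ioi 0))
    (hd₁ : ∀ l < k, ∀ x > (0 : ℝ), HasDerivAt (D₁ l) (D₁ (l + 1) x) x)
    (hd₂ : ∀ l < k, ∀ x > (0 : ℝ), HasDerivAt (D₂ l) (D₂ (l + 1) x) x)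
    (hc₁ : ∀ l ≤ k, ContinuousOn (D₁ l) (Ioi 0))
    (hc₂ : ∀ l ≤ k, ContinuousOn (D₂ l) (Ioi 0)) {j : ℕ} (hj : j ≤ k) {z w x : ℝ}
    (hz : 0 < z) (hw : 0 < w) (hzx : z < x) (hwx : w < x) :
    splitConvDeriv D₁ D₂ z j x = splitConvDeriv D₁ D₂ w j x := by
  induction j generalizing x with
  | zero =>
    simp only [splitConvDeriv, Finset.range_zero, Finset.sum_empty, add_zero]
    rw [← integral_mul_comp_sub_eq_add h₁ h₂ hi₁ hi₂ (hc₁ 0 hj) (hc₂ 0 hj) hz hzx,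
      ← integral_mul_comp_sub_eq_add h₁ h₂ hi₁ hi₂ (hc₁ 0 hj) (hc₂ 0 hj) hw hwx]
  | succ j ih =>
    refine (hasDerivAt_splitConvDeriv hi₁ hi₂ hd₁ hd₂ hc₁ hc₂ hj hz hzx).unique
      ((hasDerivAt_splitConvDeriv hi₁ hi₂ hd₁ hd₂ hc₁ hc₂ hj hw hwx).congr_of_eventuallyEq ?_)
    filter_upwards [lt_mem_nhds hzx, lt_mem_nhds hwx] with y hy hy'
    exact ih (by omega) hy hy'

/-- formulas for the `k`-th derivative of a convolution of two
functions supported on `(0,∞)`. The functions `D₁ l`, `D₂ l` play the role of the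
`l`-th derivatives of `F₁`, `F₂` on `(0,∞)`, and `C l` that of the `l`-th
derivative of the convolution. The constants `w l` depend only on `k`. -/
theorem stmt1 (k : ℕ) (hk : 1 ≤ k) :
    ∃ w : ℕ → ℝ,
      ∀ F₁ F₂ : ℝ → ℝ, ∀ D₁ D₂ : ℕ → ℝ → ℝ,
        D₁ 0 = F₁ → D₂ 0 = F₂ →
        (∀ x ≤ (0:ℝ), F₁ x = 0) → (∀ x ≤ (0:ℝ), F₂ x = 0) →
        IntegrableOn F₁ (Ioi 0) → IntegrableOn F₂ (Ioi 0) →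
        (∀ l < k, ∀ x > (0:ℝ), HasDerivAt (D₁ l) (D₁ (l + 1) x) x) →
        (∀ l < k, ∀ x > (0:ℝ), HasDerivAt (D₂ l) (D₂ (l + 1) x) x) →
        (∀ l ≤ k, ∀ c > (0:ℝ), UniformContinuousOn (D₁ l) (Ici c)) →
        (∀ l ≤ k, ∀ c > (0:ℝ), UniformContinuousOn (D₂ l) (Ici c)) →
        ∃ C : ℕ → ℝ → ℝ,
          (C 0 = fun x => ∫ y, F₁ y * F₂ (x - y)) ∧
          (∀ l < k, ∀ x > (0:ℝ), HasDerivAt (C l) (C (l + 1) x) x) ∧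
          (∀ x > (0:ℝ),
            C k x = (∫ y in (0:ℝ)..(x / 2), F₁ y * D₂ k (x - y)) +
              (∫ y in (0:ℝ)..(x / 2), F₂ y * D₁ k (x - y)) +
              ∑ l ∈ Finset.range k, w l * D₁ l (x / 2) * D₂ (k - 1 - l) (x / 2)) ∧
          (∀ z₀ > (0:ℝ), ∀ x > z₀,
            C k x = (∫ y in (0:ℝ)..z₀, F₁ y * D₂ k (x - y)) +
              (∫ y in (0:ℝ)..(x - z₀), F₂ y * D₁ k (x - y)) +
              ∑ l ∈ Finset.range k, D₁ l z₀ * D₂ (k - 1 - l) (x - z₀)) := by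
  refine ⟨fun _ => 1, ?_⟩
  rintro _ _ D₁ D₂ rfl rfl h₁ h₂ hi₁ hi₂ hd₁ hd₂ hu₁ hu₂
  have cont : ∀ D : ℕ → ℝ → ℝ, (∀ l ≤ k, ∀ c > (0:ℝ), UniformContinuousOn (D l) (Ici c)) →
      ∀ l ≤ k, ContinuousOn (D l) (Ioi 0) := fun D hD l hl x hx =>
    ((hD l hl (x / 2) (half_pos hx)).continuousOn.continuousAt
      (Ici_mem_nhds (half_lt_self hx))).continuousWithinAt
  have hc₁ := cont D₁ hu₁
  have hc₂ := cont D₂ hu₂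
  obtain ⟨n, rfl⟩ : ∃ n, k = n + 1 := ⟨k - 1, by omega⟩
  let C : ℕ → ℝ → ℝ := fun j => match j with
    | 0 => fun x => ∫ y, D₁ 0 y * D₂ 0 (x - y)
    | j + 1 => fun x => splitConvDeriv D₁ D₂ (x / 2) (j + 1) x
  have hC : ∀ j ≤ n + 1, ∀ z > (0 : ℝ), ∀ x > z, C j x = splitConvDeriv D₁ D₂ z j x := by
    intro j hj z hz x hx
    cases j with
    | zero =>
      simpa [C, splitConvDeriv] using
        integral_mul_comp_sub_eq_add h₁ h₂ hi₁ hi₂ (hc₁ 0 hj) (hc₂ 0 hj) hz hx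
    | succ j =>
      exact splitConvDeriv_eq h₁ h₂ hi₁ hi₂ hd₁ hd₂ hc₁ hc₂ hj (half_pos (hz.trans hx)) hz
        (half_lt_self (hz.trans hx)) hx
  refine ⟨C, rfl, fun l hl x hx => ?_, fun x hx => ?_, fun z hz x hx => hC _ le_rfl z hz x hx⟩
  · have hx2 := half_lt_self hx
    rw [hC (l + 1) hl _ (half_pos hx) x hx2]
    refine (hasDerivAt_splitConvDeriv hi₁ hi₂ hd₁ hd₂ hc₁ hc₂ hl (half_pos hx)
      hx2).congr_of_eventuallyEq ?_
    filter_upwards [lt_mem_nhds hx2] with y hy using hC l hl.le _ (half_pos hx) y hy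
  · simp only [C, splitConvDeriv, sub_half, one_mul]
end

section
/- Let k≥1, let F₁ be an integrable function on (0,∞) and F₂ an integrable function on (−∞,0) such that: F₁ and F₂ are k-times differentiable on their domains; for every c>0 and every 0≤l≤k, the l-th derivative of F₁ is uniformly continuous on [c,∞); F₂ is analytic at zero; and for every c>0 and every 0≤l≤k, the l-th derivative of F₂ is uniformly continuous on (−∞,−c] (hence, being analytic at zero, each derivative of F₂ extends continuously to (−∞,0]; F₂^{(l)}(0) denotes its left limit at 0). Then the convolution F₁*F₂ is k-times differentiable on (−∞,0)∪(0,∞), and for x>0: (F₁*F₂)^{(k)}(x) = ∫_x^∞ F₁(y)·F₂^{(k)}(x−y) dy − ∑_{l=0}^{k−1} F₁^{(k−l−1)}(x)·F₂^{(l)}(0), while for x<0: (F₁*F₂)^{(k)}(x) = ∫₀^∞ F₁(y)·F₂^{(k)}(x−y) dy. -/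
open MeasureTheory Set

/-- A function on the negative half-line which has a limit at `0`, is uniformly continuous away
from `0` and has a bounded antiderivative is bounded. -/
theorem exists_bound_of_hasDerivAt_of_uniformContinuousOn {G h : ℝ → ℝ} {M L : ℝ}
    (hG : ∀ x < 0, |G x| ≤ M) (hder : ∀ x < 0, HasDerivAt G (h x) x)
    (huc : ∀ c > (0:ℝ), UniformContinuousOn h (Iic (-c)))
    (hlim : Filter.Tendsto h (nhdsWithin 0 (Iio 0)) (nhds L)) :
    ∃ K, ∀ x < 0, |h x| ≤ K := by
  have hnear : ∀ᶠ x in nhdsWithin (0:ℝ) (Iio 0), |h x| < |L| + 1 :=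
    hlim.abs.eventually (gt_mem_nhds (by linarith))
  obtain ⟨a, ha, hsub⟩ := mem_nhdsLT_iff_exists_Ioo_subset.1 hnear
  have ha0 : a < 0 := ha
  have huca := huc (-a) (by linarith)
  rw [neg_neg] at huca
  obtain ⟨δ, hδ, hclose⟩ := Metric.uniformContinuousOn_iff.1 huca 1 one_pos
  refine ⟨max (|L| + 1) (1 + 2 * M / (δ / 2)), fun x hx => ?_⟩
  rcases lt_or_ge a x with hax | hxa
  · exact le_max_of_le_left (le_of_lt (hsub ⟨hax, hx⟩))
  refine le_max_of_le_right ?_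
  obtain ⟨ξ, hξ, hmean⟩ := exists_hasDerivAt_eq_slope G h (show x - δ / 2 < x by linarith)
    (fun y hy => (hder y (lt_of_le_of_lt hy.2 hx)).continuousAt.continuousWithinAt)
    (fun y hy => hder y (hy.2.trans hx))
  have hdist : |h x - h ξ| < 1 := by
    have := hclose x hxa ξ (hξ.2.le.trans hxa)
      (by rw [Real.dist_eq, abs_lt]; constructor <;> linarith [hξ.1, hξ.2])
    rwa [Real.dist_eq] at this
  have hslope : |h ξ| ≤ 2 * M / (δ / 2) := by
    rw [hmean, sub_sub_cancel, abs_div, abs_of_pos (half_pos hδ)]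
    gcongr
    have h₁ := hG x hx
    have h₂ := hG (x - δ / 2) (by linarith)
    linarith [abs_sub (G x) (G (x - δ / 2))]
  linarith [abs_sub_abs_le_abs_sub (h x) (h ξ)]

/-- An integrable function on the line which is continuous on the negative half-line has a bounded
antiderivative there. -/
theorem exists_bounded_hasDerivAt_of_integrable {f : ℝ → ℝ} (hf : Integrable f)
    (hcont : ∀ x < 0, ContinuousAt f x) :
    ∃ G : ℝ → ℝ, ∃ M, (∀ x < 0, |G x| ≤ M) ∧ ∀ x < 0, HasDerivAt G (f x) x := by
  refine ⟨fun x => ∫ t in (0:ℝ)..x, f t, ∫ t, ‖f t‖, fun x _ => ?_, fun x hx => ?_⟩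
  · rw [← Real.norm_eq_abs]
    refine intervalIntegral.norm_integral_le_integral_norm_uIoc.trans ?_
    exact setIntegral_le_integral hf.norm (Filter.Eventually.of_forall fun _ => norm_nonneg _)
  · exact intervalIntegral.integral_hasDerivAt_right hf.intervalIntegrable
      hf.aestronglyMeasurable.stronglyMeasurableAtFilter (hcont x hx)

/-- A bounded `C¹` function on the negative half-line, with bounded derivative, whose one-sided
limits at `0` exist, extends to a differentiable function on the line with the same properties. -/
theorem exists_bounded_hasDerivAt_extension {h h' : ℝ → ℝ} {L L' K K' : ℝ}
    (hK : ∀ x < 0, |h x| ≤ K) (hK' : ∀ x < 0, |h' x| ≤ K')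
    (hder : ∀ x < 0, HasDerivAt h (h' x) x)
    (hlim : Filter.Tendsto h (nhdsWithin 0 (Iio 0)) (nhds L))
    (hlim' : Filter.Tendsto h' (nhdsWithin 0 (Iio 0)) (nhds L')) :
    ∃ H H' : ℝ → ℝ, ∃ M, (∀ x, |H x| ≤ M) ∧ (∀ x, |H' x| ≤ M) ∧
      (∀ x, HasDerivAt H (H' x) x) ∧ EqOn H h (Iio 0) ∧ EqOn H' h' (Iio 0) ∧ H 0 = L := by
  set H : ℝ → ℝ := fun u => if u < 0 then h u else L + L' * Real.sin u with hH
  set H' : ℝ → ℝ := fun u => if u < 0 then h' u else L' * Real.cos u with hH'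
  have hHneg : EqOn H h (Iio 0) := fun u hu => if_pos hu
  have hH'neg : EqOn H' h' (Iio 0) := fun u hu => if_pos hu
  have hHnonneg : EqOn H (fun u => L + L' * Real.sin u) (Ici 0) := fun u hu => if_neg (not_lt.2 hu)
  have hH'nonneg : EqOn H' (fun u => L' * Real.cos u) (Ici 0) := fun u hu => if_neg (not_lt.2 hu)
  have hHzero : H 0 = L := by simp [hH]
  have hH'zero : H' 0 = L' := by simp [hH']
  have hsin : ∀ u, HasDerivAt (fun u => L + L' * Real.sin u) (L' * Real.cos u) u := fun u =>
    ((Real.hasDerivAt_sin u).const_mul L').const_add L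
  have hderneg : ∀ x < 0, HasDerivAt H (h' x) x := fun x hx =>
    (hder x hx).congr_of_eventuallyEq (hHneg.eventuallyEq_of_mem (Iio_mem_nhds hx))
  refine ⟨H, H', max (max K K') (|L| + |L'|), fun x => ?_, fun x => ?_, fun x => ?_,
    hHneg, hH'neg, hHzero⟩
  · rcases lt_or_ge x 0 with hx | hx
    · rw [hHneg hx]
      exact (hK x hx).trans ((le_max_left _ _).trans (le_max_left _ _))
    · rw [hHnonneg hx]
      refine le_max_of_le_right ((abs_add_le _ _).trans ?_)
      rw [abs_mul]
      gcongr
      exact mul_le_of_le_one_right (abs_nonneg _) (Real.abs_sin_le_one x)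
  · rcases lt_or_ge x 0 with hx | hx
    · rw [hH'neg hx]
      exact (hK' x hx).trans ((le_max_right _ _).trans (le_max_left _ _))
    · rw [hH'nonneg hx]
      refine le_max_of_le_right ?_
      rw [abs_mul]
      linarith [mul_le_of_le_one_right (abs_nonneg L') (Real.abs_cos_le_one x), abs_nonneg L]
  · rcases lt_trichotomy x 0 with hx | rfl | hx
    · rw [hH'neg hx]
      exact hderneg x hx
    · rw [hH'zero]
      have hleft : HasDerivWithinAt H L' (Iic 0) 0 := by
        refine hasDerivWithinAt_Iic_of_tendsto_deriv (s := Iio 0)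
          (fun x hx => (hderneg x hx).differentiableAt.differentiableWithinAt) ?_
          self_mem_nhdsWithin ?_
        · rw [ContinuousWithinAt, hHzero]
          exact hlim.congr' (hHneg.symm.eventuallyEq_of_mem self_mem_nhdsWithin)
        · refine hlim'.congr' (Filter.eventuallyEq_of_mem self_mem_nhdsWithin fun x hx => ?_)
          exact (hderneg x hx).deriv.symm
      have hright : HasDerivWithinAt H L' (Ici 0) 0 := by
        have := (hsin 0).hasDerivWithinAt (s := Ici 0)
        rw [Real.cos_zero, mul_one] at this
        exact this.congr hHnonneg (hHnonneg self_mem_Ici)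
      have := hleft.union hright
      rwa [Iic_union_Ici, hasDerivWithinAt_univ] at this
    · rw [hH'nonneg hx.le]
      exact (hsin x).congr_of_eventuallyEq
        ((hHnonneg.mono Ioi_subset_Ici_self).eventuallyEq_of_mem (Ioi_mem_nhds hx))

section

variable {f H H' : ℝ → ℝ} {M : ℝ}

theorem integrable_mul_comp_sub (hf : Integrable f) (hHM : ∀ x, |H x| ≤ M)
    (hH : Measurable H) (x : ℝ) : Integrable fun y => f y * H (x - y) :=
  hf.mul_bdd (c := M) (hH.comp (measurable_const.sub measurable_id)).aestronglyMeasurable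
    (Filter.Eventually.of_forall fun _ => hHM _)

/-- Differentiation under the integral sign for a partial convolution. -/
theorem hasDerivAt_setIntegral_mul_comp_sub (hf : Integrable f) (hHM : ∀ x, |H x| ≤ M)
    (hH'M : ∀ x, |H' x| ≤ M) (hder : ∀ x, HasDerivAt H (H' x) x) (S : Set ℝ) (x₀ : ℝ) :
    HasDerivAt (fun x => ∫ y in S, f y * H (x - y)) (∫ y in S, f y * H' (x₀ - y)) x₀ := by
  have hHmeas : Measurable H :=
    (continuous_iff_continuousAt.2 fun x => (hder x).continuousAt).measurable
  have hH'meas : Measurable H' := by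
    rw [← funext fun x => (hder x).deriv]
    exact measurable_deriv H
  refine (hasDerivAt_integral_of_dominated_loc_of_deriv_le (F := fun x y => f y * H (x - y))
    (F' := fun x y => f y * H' (x - y)) (bound := fun y => ‖f y‖ * M) Filter.univ_mem
    (Filter.Eventually.of_forall fun x =>
      (integrable_mul_comp_sub hf hHM hHmeas x).aestronglyMeasurable.restrict)
    (integrable_mul_comp_sub hf hHM hHmeas x₀).restrict
    (integrable_mul_comp_sub hf hH'M hH'meas x₀).aestronglyMeasurable.restrict
    (Filter.Eventually.of_forall fun y x _ => ?_) (hf.norm.mul_const M).restrict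
    (Filter.Eventually.of_forall fun y x _ => ?_)).2
  · rw [norm_mul]
    exact mul_le_mul_of_nonneg_left (hH'M _) (norm_nonneg _)
  · exact ((hder (x - y)).comp_sub_const x y).const_mul (f y)

/-- The derivative of `∫_{x₀}^x f(y) H(x - y) dy` at `x = x₀`. -/
theorem hasDerivAt_intervalIntegral_mul_comp_sub_s2 {x₀ : ℝ} (hf : Integrable f)
    (hHM : ∀ x, |H x| ≤ M) (hH : Continuous H) (hfc : ContinuousAt f x₀) :
    HasDerivAt (fun x => ∫ y in x₀..x, f y * H (x - y)) (f x₀ * H 0) x₀ := by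
  rw [hasDerivAt_iff_isLittleO, Asymptotics.isLittleO_iff]
  intro ε hε
  have hprod : ContinuousAt (fun p : ℝ × ℝ => f p.1 * H p.2) (x₀, 0) :=
    (ContinuousAt.comp (f := Prod.fst) (x := (x₀, (0:ℝ))) hfc continuousAt_fst).mul
      (hH.comp continuous_snd).continuousAt
  obtain ⟨δ, hδ, hclose⟩ := Metric.continuousAt_iff.1 hprod ε hε
  filter_upwards [Metric.ball_mem_nhds x₀ hδ] with x hx
  rw [Metric.mem_ball, Real.dist_eq] at hx
  have hrw : (∫ y in x₀..x, f y * H (x - y)) - (∫ y in x₀..x₀, f y * H (x₀ - y)) -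
      (x - x₀) • (f x₀ * H 0) = ∫ y in x₀..x, (f y * H (x - y) - f x₀ * H 0) := by
    rw [intervalIntegral.integral_same, sub_zero, intervalIntegral.integral_sub
      (integrable_mul_comp_sub hf hHM hH.measurable x).intervalIntegrable
      intervalIntegrable_const, intervalIntegral.integral_const]
  rw [hrw, Real.norm_eq_abs (x - x₀)]
  refine intervalIntegral.norm_integral_le_of_norm_le_const fun y hy => ?_
  have hy' := uIoc_subset_uIcc hy
  have h₁ : |y - x₀| ≤ |x - x₀| := abs_sub_left_of_mem_uIcc hy'
  have h₂ : |x - y| ≤ |x - x₀| := abs_sub_right_of_mem_uIcc hy'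
  have := hclose (x := (y, x - y)) (by
    rw [Prod.dist_eq, max_lt_iff, Real.dist_eq, Real.dist_eq, sub_zero]
    exact ⟨h₁.trans_lt hx, h₂.trans_lt hx⟩)
  exact (Real.dist_eq _ _ ▸ this).le

/-- The derivative of `∫_x^∞ f(y) H(x - y) dy`. -/
theorem hasDerivAt_setIntegral_Ioi_mul_comp_sub {x₀ : ℝ} (hf : Integrable f)
    (hHM : ∀ x, |H x| ≤ M) (hH'M : ∀ x, |H' x| ≤ M) (hder : ∀ x, HasDerivAt H (H' x) x)
    (hfc : ContinuousAt f x₀) :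
    HasDerivAt (fun x => ∫ y in Ioi x, f y * H (x - y))
      ((∫ y in Ioi x₀, f y * H' (x₀ - y)) - f x₀ * H 0) x₀ := by
  have hH : Continuous H := continuous_iff_continuousAt.2 fun x => (hder x).continuousAt
  refine ((hasDerivAt_setIntegral_mul_comp_sub hf hHM hH'M hder (Ioi x₀) x₀).sub
    (hasDerivAt_intervalIntegral_mul_comp_sub_s2 hf hHM hH hfc)).congr_of_eventuallyEq
    (Filter.Eventually.of_forall fun x => ?_)
  have hint := integrable_mul_comp_sub hf hHM hH.measurable x
  have := intervalIntegral.integral_Ioi_sub_Ioi' (a := x₀) (b := x) hint.integrableOn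
    hint.integrableOn
  simp only [Pi.sub_apply]
  linarith

end

/-- derivatives of the convolution of `F₁` supported on `(0,∞)` with
`F₂` supported on `(−∞,0)`.  Here `D₁ l`, `D₂ l` play the role of the `l`-th
derivatives of `F₁`, `F₂` on their domains, `L l` is the left limit of `D₂ l`
at `0` (i.e. `F₂^{(l)}(0)`), and `C l` that of the `l`-th derivative of the
convolution on `(−∞,0)∪(0,∞)`. -/
theorem stmt2 (k : ℕ) (hk : 1 ≤ k)
    (F₁ F₂ : ℝ → ℝ) (D₁ D₂ : ℕ → ℝ → ℝ) (L : ℕ → ℝ)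
    (hD₁0 : D₁ 0 = F₁) (hD₂0 : D₂ 0 = F₂)
    (hsupp₁ : ∀ x ≤ (0:ℝ), F₁ x = 0) (hsupp₂ : ∀ x ≥ (0:ℝ), F₂ x = 0)
    (hint₁ : IntegrableOn F₁ (Ioi 0)) (hint₂ : IntegrableOn F₂ (Iio 0))
    (hder₁ : ∀ l < k, ∀ x > (0:ℝ), HasDerivAt (D₁ l) (D₁ (l + 1) x) x)
    (hder₂ : ∀ l < k, ∀ x < (0:ℝ), HasDerivAt (D₂ l) (D₂ (l + 1) x) x)
    (huc₁ : ∀ l ≤ k, ∀ c > (0:ℝ), UniformContinuousOn (D₁ l) (Ici c))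
    (hanal₂ : ∃ ε > (0:ℝ), ∃ g : ℝ → ℝ, (∀ x ∈ Ioo (-ε) ε, AnalyticAt ℝ g x) ∧
      ∀ x ∈ Ioo (-ε) (0:ℝ), g x = F₂ x)
    (huc₂ : ∀ l ≤ k, ∀ c > (0:ℝ), UniformContinuousOn (D₂ l) (Iic (-c)))
    (hlim₂ : ∀ l ≤ k, Filter.Tendsto (D₂ l) (nhdsWithin 0 (Iio 0)) (nhds (L l))) :
    ∃ C : ℕ → ℝ → ℝ,
      (C 0 = fun x => ∫ y, F₁ y * F₂ (x - y)) ∧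
      (∀ l < k, ∀ x : ℝ, x ≠ 0 → HasDerivAt (C l) (C (l + 1) x) x) ∧
      (∀ x > (0:ℝ),
        C k x = (∫ y in Ioi x, F₁ y * D₂ k (x - y)) -
          ∑ l ∈ Finset.range k, D₁ (k - l - 1) x * L l) ∧
      (∀ x < (0:ℝ), C k x = ∫ y in Ioi (0:ℝ), F₁ y * D₂ k (x - y)) := by
  have hF₁ : Integrable F₁ := (integrableOn_iff_integrable_of_support_subset fun x hx =>
    not_le.1 fun h => hx (hsupp₁ x h)).1 hint₁
  have hF₂ : Integrable F₂ := (integrableOn_iff_integrable_of_support_subset fun x hx =>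
    not_le.1 fun h => hx (hsupp₂ x h)).1 hint₂
  have hbound : ∀ l ≤ k, ∃ K, ∀ x < 0, |D₂ l x| ≤ K := by
    intro l
    induction l with
    | zero =>
      intro _
      obtain ⟨G, M, hG, hGder⟩ := exists_bounded_hasDerivAt_of_integrable hF₂
        fun x hx => hD₂0 ▸ (hder₂ 0 hk x hx).continuousAt
      rw [← hD₂0] at hGder
      exact exists_bound_of_hasDerivAt_of_uniformContinuousOn hG hGder (huc₂ 0 k.zero_le)
        (hlim₂ 0 k.zero_le)
    | succ l ih =>
      intro hl
      obtain ⟨M, hM⟩ := ih (Nat.le_of_succ_le hl)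
      exact exists_bound_of_hasDerivAt_of_uniformContinuousOn hM (hder₂ l hl) (huc₂ (l + 1) hl)
        (hlim₂ (l + 1) hl)
  set C : ℕ → ℝ → ℝ := fun l x => if 0 < x then (∫ y in Ioi x, F₁ y * D₂ l (x - y)) -
    ∑ j ∈ Finset.range l, D₁ (l - j - 1) x * L j
    else ∫ y in Ioi (0:ℝ), F₁ y * D₂ l (x - y) with hC
  have hCpos : ∀ l, ∀ x > 0, C l x = (∫ y in Ioi x, F₁ y * D₂ l (x - y)) -
    ∑ j ∈ Finset.range l, D₁ (l - j - 1) x * L j := fun l x hx => if_pos hx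
  have hCneg : ∀ l, ∀ x ≤ 0, C l x = ∫ y in Ioi (0:ℝ), F₁ y * D₂ l (x - y) :=
    fun l x hx => if_neg (not_lt.2 hx)
  refine ⟨C, ?_, ?_, hCpos k, fun x hx => hCneg k x hx.le⟩
  · funext x
    rcases lt_or_ge 0 x with hx | hx
    · rw [hCpos 0 x hx, hD₂0, Finset.sum_range_zero, sub_zero]
      refine setIntegral_eq_integral_of_forall_compl_eq_zero fun y hy => ?_
      rw [hsupp₂ (x - y) (sub_nonneg.2 (not_lt.1 hy)), mul_zero]
    · rw [hCneg 0 x hx, hD₂0]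
      refine setIntegral_eq_integral_of_forall_compl_eq_zero fun y hy => ?_
      rw [hsupp₁ y (not_lt.1 hy), zero_mul]
  intro l hl x hx
  obtain ⟨K, hK⟩ := hbound l hl.le
  obtain ⟨K', hK'⟩ := hbound (l + 1) hl
  obtain ⟨H, H', M, hHM, hH'M, hder, hHeq, hH'eq, hH0⟩ := exists_bounded_hasDerivAt_extension
    hK hK' (hder₂ l hl) (hlim₂ l hl.le) (hlim₂ (l + 1) hl)
  have hcongr : ∀ {A B : ℝ → ℝ} (_ : EqOn A B (Iio 0)) {a z : ℝ} (_ : z ≤ a),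
      ∫ y in Ioi a, F₁ y * A (z - y) = ∫ y in Ioi a, F₁ y * B (z - y) := fun hAB a z hz =>
    setIntegral_congr_fun measurableSet_Ioi fun y (hy : a < y) => by
      simp only [hAB (show z - y < 0 by linarith)]
  rcases lt_or_gt_of_ne hx with hx | hx
  · rw [hCneg (l + 1) x hx.le, ← hcongr hH'eq hx.le]
    refine (hasDerivAt_setIntegral_mul_comp_sub hF₁ hHM hH'M hder _ x).congr_of_eventuallyEq ?_
    filter_upwards [Iio_mem_nhds hx] with z hz
    rw [hCneg l z (le_of_lt hz), hcongr hHeq (le_of_lt hz)]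
  · have hsum : HasDerivAt (fun z => ∑ j ∈ Finset.range l, D₁ (l - j - 1) z * L j)
        (∑ j ∈ Finset.range l, D₁ (l + 1 - j - 1) x * L j) x := by
      refine HasDerivAt.fun_sum fun j hj => HasDerivAt.mul_const ?_ (L j)
      have hjl := Finset.mem_range.1 hj
      rw [show l + 1 - j - 1 = l - j - 1 + 1 by omega]
      exact hder₁ (l - j - 1) (by omega) x hx
    have hmain := (hasDerivAt_setIntegral_Ioi_mul_comp_sub hF₁ hHM hH'M hder
      (hD₁0 ▸ (hder₁ 0 hk x hx).continuousAt)).sub hsum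
    rw [hCpos (l + 1) x hx, ← hcongr hH'eq le_rfl, Finset.sum_range_succ, ← sub_sub,
      sub_right_comm, Nat.add_sub_cancel_left, Nat.sub_self, hD₁0, ← hH0]
    refine hmain.congr_of_eventuallyEq ?_
    filter_upwards [Ioi_mem_nhds hx] with z hz
    rw [hCpos l z hz, ← hcongr hHeq le_rfl, Pi.sub_apply]
end

section
/- Let F₁,F₂ be integrable functions on (0,∞) such that for some ε>0: F₁(x)=x^{a₁}·∑_{n=0}^∞ Bₙxⁿ and F₂(x)=x^{a₂}·∑_{n=0}^∞ Cₙxⁿ for all x∈(0,ε), where a₁,a₂>−1 and both power series converge on (−ε,ε). Then there exists δ>0 such that for all x∈(0,δ): (F₁*F₂)(x) = ∑_{n=0}^∞ ( ∑_{k=0}^n B_k·C_{n−k}·Γ(k+a₁+1)·Γ(n−k+a₂+1)/Γ(n+a₁+a₂+2) )·x^{n+a₁+a₂+1}, the series converging absolutely. -/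
open MeasureTheory Set

theorem setIntegral_Ioo_rpow_mul_sub_rpow {s t x : ℝ} (hs : 0 < s) (ht : 0 < t) (hx : 0 < x) :
    ∫ y in Ioo 0 x, y ^ (s - 1) * (x - y) ^ (t - 1) =
      Real.Gamma s * Real.Gamma t / Real.Gamma (s + t) * x ^ (s + t - 1) := by
  have h := Complex.betaIntegral_scaled s t hx
  rw [Complex.betaIntegral_eq_Gamma_mul_div _ _ (by simpa) (by simpa),
    intervalIntegral.integral_of_le hx.le, integral_Ioc_eq_integral_Ioo] at h
  have key : ∫ y in Ioo 0 x, (y : ℂ) ^ ((s : ℂ) - 1) * ((x : ℂ) - y) ^ ((t : ℂ) - 1) =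
      ∫ y in Ioo 0 x, ((y ^ (s - 1) * (x - y) ^ (t - 1) : ℝ) : ℂ) := by
    refine setIntegral_congr_fun measurableSet_Ioo fun y hy => ?_
    simp only [Complex.ofReal_mul, Complex.ofReal_cpow hy.1.le,
      Complex.ofReal_cpow (sub_nonneg.2 hy.2.le), Complex.ofReal_sub, Complex.ofReal_one]
  rw [key, integral_complex_ofReal, ← Complex.ofReal_add, Complex.Gamma_ofReal,
    Complex.Gamma_ofReal, Complex.Gamma_ofReal, ← Complex.ofReal_one, ← Complex.ofReal_sub,
    ← Complex.ofReal_cpow hx.le] at h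
  rw [mul_comm]
  exact_mod_cast h

theorem integrableOn_Ioo_rpow_mul_sub_rpow {s t x : ℝ} (hs : 0 < s) (ht : 0 < t) (hx : 0 < x) :
    IntegrableOn (fun y => y ^ (s - 1) * (x - y) ^ (t - 1)) (Ioo 0 x) := by
  refine not_imp_comm.1 integral_undef ?_
  rw [setIntegral_Ioo_rpow_mul_sub_rpow hs ht hx]
  have h₁ := Real.Gamma_pos_of_pos hs
  have h₂ := Real.Gamma_pos_of_pos ht
  have h₃ := Real.Gamma_pos_of_pos (add_pos hs ht)
  positivity

theorem HasSum.sum_range_prod {f : ℕ × ℕ → ℝ} {a : ℝ} (h : HasSum f a) :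
    HasSum (fun n => ∑ k ∈ Finset.range (n + 1), f (k, n - k)) a := by
  simp_rw [← Finset.Nat.sum_antidiagonal_eq_sum_range_succ fun k l => f (k, l)]
  refine (Finset.HasAntidiagonal.sigmaAntidiagonalEquivProd.hasSum_iff.2 h).sigma fun n => ?_
  rw [← Finset.sum_coe_sort]
  exact hasSum_fintype _

theorem abs_mul_pow_le_abs_mul_pow {x y : ℝ} (hy : y ∈ Icc 0 x) (c : ℝ) (n : ℕ) :
    |c * y ^ n| ≤ |c * x ^ n| := by
  rw [abs_mul, abs_mul, abs_of_nonneg (pow_nonneg hy.1 n),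
    abs_of_nonneg (pow_nonneg (hy.1.trans hy.2) n)]
  exact mul_le_mul_of_nonneg_left (pow_le_pow_left₀ hy.1 hy.2 n) (abs_nonneg c)

theorem summable_mul_pow_of_mem_Icc {x y : ℝ} {c : ℕ → ℝ} (hc : Summable fun n => c n * x ^ n)
    (hy : y ∈ Icc 0 x) : Summable fun n => c n * y ^ n :=
  (hc.abs.of_nonneg_of_le (fun _ => abs_nonneg _)
    fun n => abs_mul_pow_le_abs_mul_pow hy (c n) n).of_abs

theorem setIntegral_Ioo_rpow_mul_sub_rpow_mul_pow {a₁ a₂ x : ℝ} (ha₁ : -1 < a₁) (ha₂ : -1 < a₂)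
    (hx : 0 < x) (b c : ℝ) (k l : ℕ) :
    ∫ y in Ioo 0 x, y ^ a₁ * (x - y) ^ a₂ * ((b * y ^ k) * (c * (x - y) ^ l)) =
      b * c * Real.Gamma (k + a₁ + 1) * Real.Gamma (l + a₂ + 1) /
        Real.Gamma (k + l + a₁ + a₂ + 2) * x ^ ((k : ℝ) + l + a₁ + a₂ + 1) := by
  have hs : 0 < (k : ℝ) + a₁ + 1 := by linarith [k.cast_nonneg (α := ℝ)]
  have ht : 0 < (l : ℝ) + a₂ + 1 := by linarith [l.cast_nonneg (α := ℝ)]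
  have hbeta := setIntegral_Ioo_rpow_mul_sub_rpow hs ht hx
  rw [show (k : ℝ) + a₁ + 1 + (l + a₂ + 1) = k + l + a₁ + a₂ + 2 by ring,
    show (k : ℝ) + l + a₁ + a₂ + 2 - 1 = k + l + a₁ + a₂ + 1 by ring] at hbeta
  calc _ = b * c * ∫ y in Ioo 0 x,
        y ^ ((k : ℝ) + a₁ + 1 - 1) * (x - y) ^ ((l : ℝ) + a₂ + 1 - 1) := by
        rw [← integral_const_mul]
        refine setIntegral_congr_fun measurableSet_Ioo fun y hy => ?_
        simp only [add_sub_cancel_right]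
        rw [add_comm (k : ℝ), add_comm (l : ℝ), Real.rpow_add_natCast hy.1.ne',
          Real.rpow_add_natCast (sub_pos.2 hy.2).ne']
        ring
    _ = _ := by
        rw [hbeta]
        ring

/-- Term-by-term integration of the product of two power series against
`y ^ a₁ * (x - y) ^ a₂`. -/
theorem hasSum_setIntegral_rpow_mul_powerSeries {a₁ a₂ x : ℝ} {B C : ℕ → ℝ} (ha₁ : -1 < a₁)
    (ha₂ : -1 < a₂) (hx : 0 < x) (hB : Summable fun n => B n * x ^ n)
    (hC : Summable fun n => C n * x ^ n) :
    HasSum (fun p : ℕ × ℕ => B p.1 * C p.2 * Real.Gamma (p.1 + a₁ + 1) *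
        Real.Gamma (p.2 + a₂ + 1) / Real.Gamma (p.1 + p.2 + a₁ + a₂ + 2) *
        x ^ ((p.1 : ℝ) + p.2 + a₁ + a₂ + 1))
      (∫ y in Ioo 0 x, (y ^ a₁ * ∑' n, B n * y ^ n) *
        ((x - y) ^ a₂ * ∑' n, C n * (x - y) ^ n)) := by
  have hBC : Summable fun p : ℕ × ℕ => |B p.1 * x ^ p.1| * |C p.2 * x ^ p.2| :=
    hB.abs.mul_of_nonneg hC.abs (fun _ => abs_nonneg _) (fun _ => abs_nonneg _)
  have hint : IntegrableOn (fun y => y ^ a₁ * (x - y) ^ a₂) (Ioo 0 x) := by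
    simpa using integrableOn_Ioo_rpow_mul_sub_rpow (s := a₁ + 1) (t := a₂ + 1)
      (by linarith) (by linarith) hx
  have hmem : ∀ y ∈ Ioo 0 x, y ∈ Icc 0 x ∧ x - y ∈ Icc 0 x := fun y hy =>
    ⟨⟨hy.1.le, hy.2.le⟩, sub_nonneg.2 hy.2.le, by linarith [hy.1]⟩
  simp_rw [← setIntegral_Ioo_rpow_mul_sub_rpow_mul_pow ha₁ ha₂ hx]
  refine hasSum_integral_of_dominated_convergence
    (fun p y => (y ^ a₁ * (x - y) ^ a₂) * (|B p.1 * x ^ p.1| * |C p.2 * x ^ p.2|))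
    (fun p => by fun_prop) (fun p => ?_) (.of_forall fun y => hBC.mul_left _) ?_ ?_
  · refine (ae_restrict_iff' measurableSet_Ioo).2 (.of_forall fun y hy => ?_)
    have h := mul_nonneg (Real.rpow_nonneg (hmem y hy).1.1 a₁)
      (Real.rpow_nonneg (hmem y hy).2.1 a₂)
    rw [Real.norm_eq_abs, abs_mul, abs_of_nonneg h, abs_mul]
    exact mul_le_mul_of_nonneg_left (mul_le_mul (abs_mul_pow_le_abs_mul_pow (hmem y hy).1 _ _)
      (abs_mul_pow_le_abs_mul_pow (hmem y hy).2 _ _) (abs_nonneg _) (abs_nonneg _)) h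
  · simp_rw [tsum_mul_left]
    exact hint.mul_const _
  · refine (ae_restrict_iff' measurableSet_Ioo).2 (.of_forall fun y hy => ?_)
    have hB' := summable_mul_pow_of_mem_Icc hB (hmem y hy).1
    have hC' := summable_mul_pow_of_mem_Icc hC (hmem y hy).2
    rw [mul_mul_mul_comm]
    have hprod : Summable fun p : ℕ × ℕ => (B p.1 * y ^ p.1) * (C p.2 * (x - y) ^ p.2) :=
      summable_mul_of_summable_norm (f := fun n => B n * y ^ n)
        (g := fun n => C n * (x - y) ^ n) hB'.norm hC'.norm
    exact (hB'.hasSum.mul hC'.hasSum hprod).mul_left _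

/-- power series expansion of the convolution of two functions which
behave like `x^{a₁}·∑ Bₙxⁿ` and `x^{a₂}·∑ Cₙxⁿ` near `0⁺`. -/
theorem stmt3 (F₁ F₂ : ℝ → ℝ) (a₁ a₂ : ℝ) (B C : ℕ → ℝ) (ε : ℝ) (hε : 0 < ε)
    (ha₁ : -1 < a₁) (ha₂ : -1 < a₂)
    (hsupp₁ : ∀ x ≤ (0:ℝ), F₁ x = 0) (hsupp₂ : ∀ x ≤ (0:ℝ), F₂ x = 0)
    (hint₁ : IntegrableOn F₁ (Ioi 0)) (hint₂ : IntegrableOn F₂ (Ioi 0))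
    (hsum₁ : ∀ x ∈ Ioo (-ε) ε, Summable fun n => B n * x ^ n)
    (hsum₂ : ∀ x ∈ Ioo (-ε) ε, Summable fun n => C n * x ^ n)
    (hF₁ : ∀ x ∈ Ioo (0:ℝ) ε, F₁ x = x ^ a₁ * ∑' n, B n * x ^ n)
    (hF₂ : ∀ x ∈ Ioo (0:ℝ) ε, F₂ x = x ^ a₂ * ∑' n, C n * x ^ n) :
    ∃ δ > (0:ℝ), ∀ x ∈ Ioo (0:ℝ) δ,
      ((∫ y, F₁ y * F₂ (x - y)) =
        ∑' n : ℕ, (∑ k ∈ Finset.range (n + 1),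
            B k * C (n - k) * Real.Gamma ((k : ℝ) + a₁ + 1) *
              Real.Gamma (((n - k : ℕ) : ℝ) + a₂ + 1) /
              Real.Gamma ((n : ℝ) + a₁ + a₂ + 2)) * x ^ ((n : ℝ) + a₁ + a₂ + 1)) ∧
      Summable (fun n : ℕ =>
        |(∑ k ∈ Finset.range (n + 1),
            B k * C (n - k) * Real.Gamma ((k : ℝ) + a₁ + 1) *
              Real.Gamma (((n - k : ℕ) : ℝ) + a₂ + 1) /
              Real.Gamma ((n : ℝ) + a₁ + a₂ + 2)) * x ^ ((n : ℝ) + a₁ + a₂ + 1)|) := by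
  refine ⟨ε, hε, fun x hx => ?_⟩
  have hxε : x ∈ Ioo (-ε) ε := ⟨by linarith [hx.1], hx.2⟩
  have hconv : ∫ y, F₁ y * F₂ (x - y) = ∫ y in Ioo 0 x, (y ^ a₁ * ∑' n, B n * y ^ n) *
      ((x - y) ^ a₂ * ∑' n, C n * (x - y) ^ n) := by
    rw [← setIntegral_eq_integral_of_forall_compl_eq_zero (s := Ioo 0 x)]
    · refine setIntegral_congr_fun measurableSet_Ioo fun y hy => ?_
      rw [hF₁ y ⟨hy.1, hy.2.trans hx.2⟩,
        hF₂ (x - y) ⟨sub_pos.2 hy.2, by linarith [hy.1, hx.2]⟩]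
    · intro y hy
      rcases le_or_gt y 0 with h | h
      · rw [hsupp₁ y h, zero_mul]
      · rw [hsupp₂ (x - y) (sub_nonpos.2 (not_lt.1 fun h' => hy ⟨h, h'⟩)), mul_zero]
  have hsum := (hasSum_setIntegral_rpow_mul_powerSeries ha₁ ha₂ hx.1 (hsum₁ x hxε)
    (hsum₂ x hxε)).sum_range_prod
  rw [← hconv] at hsum
  have hterm : HasSum (fun n : ℕ => (∑ k ∈ Finset.range (n + 1),
      B k * C (n - k) * Real.Gamma ((k : ℝ) + a₁ + 1) *
        Real.Gamma (((n - k : ℕ) : ℝ) + a₂ + 1) /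
        Real.Gamma ((n : ℝ) + a₁ + a₂ + 2)) * x ^ ((n : ℝ) + a₁ + a₂ + 1))
      (∫ y, F₁ y * F₂ (x - y)) := by
    convert! hsum using 2 with n
    rw [Finset.sum_mul]
    refine Finset.sum_congr rfl fun k hk => ?_
    have hkn : (k : ℝ) + ((n - k : ℕ) : ℝ) = n := by
      exact_mod_cast Nat.add_sub_of_le (Finset.mem_range_succ_iff.1 hk)
    simp only [hkn]
  exact ⟨hterm.tsum_eq.symm, hterm.summable.abs⟩
end

section
/- Let a∈(−1,0) and let F be an integrable function on (0,∞) which is smooth on (0,∞), all of whose derivatives decay sufficiently fast, and such that for some ε>0, F(x)=x^a·∑_{n=0}^∞ Aₙxⁿ for all x∈(0,ε), with the power series convergent on (−ε,ε). Define W(x)=∑_{k∈ℤ} F(x+k) for x∈(−1/2,1/2)∖{0}. Then A₀ = lim_{x→0⁺} x^{−a}·(W(x)−W(−x)), and for every k≥1: A_k = (Γ(1+a)/Γ(k+1+a)) · lim_{x→0⁺} [ x^{−a}·(W^{(k)}(x)−W^{(k)}(−x)) − ∑_{r=1}^{k} A_{k−r}·(Γ(k+a−r+1)/Γ(a−r+1))·x^{−r}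 ]. In particular, the function (· mod 1)_*(F) determines all the coefficients Aₙ. -/
open MeasureTheory Set Filter

open Topology

/-- A sequence of functions, each the derivative of the previous one on an open set, consists of
the iterated derivatives of the first one. -/
lemma iteratedDeriv_eqOn_of_hasDerivAt {s : Set ℝ} (hs : IsOpen s) {f : ℝ → ℝ} {h : ℕ → ℝ → ℝ}
    (hf : EqOn f (h 0) s) (hh : ∀ n, ∀ x ∈ s, HasDerivAt (h n) (h (n + 1) x) x) (n : ℕ) :
    EqOn (iteratedDeriv n f) (h n) s := by
  induction n with
  | zero => simpa using hf
  | succ n ih =>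
    intro x hx
    rw [iteratedDeriv_succ, (ih.eventuallyEq_of_mem (hs.mem_nhds hx)).deriv_eq]
    exact (hh n x hx).deriv

lemma ContDiffOn.hasDerivAt_iteratedDeriv {s : Set ℝ} (hs : IsOpen s) {f : ℝ → ℝ}
    (hf : ContDiffOn ℝ (⊤ : ℕ∞) f s) (n : ℕ) {x : ℝ} (hx : x ∈ s) :
    HasDerivAt (iteratedDeriv n f) (iteratedDeriv (n + 1) f x) x := by
  have h := hf.differentiableOn_iteratedDerivWithin (m := n) (mod_cast WithTop.coe_lt_top _)
    hs.uniqueDiffOn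
  have h' := (h.congr (iteratedDerivWithin_of_isOpen hs).symm).differentiableAt (hs.mem_nhds hx)
  rw [iteratedDeriv_succ]
  exact h'.hasDerivAt

lemma analyticAt_tsum_mul_pow {B : ℕ → ℝ} {ρ : ℝ} (hρ : 0 < ρ)
    (hB : Summable fun n => B n * ρ ^ n) : AnalyticAt ℝ (fun x => ∑' n, B n * x ^ n) 0 := by
  set p := FormalMultilinearSeries.ofScalars ℝ B
  have hr : (Real.toNNReal ρ : ENNReal) ≤ p.radius := by
    refine p.le_radius_of_tendsto (l := 0) ?_
    have := hB.tendsto_atTop_zero.norm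
    simpa [p, abs_mul, abs_of_pos hρ, hρ.le] using this
  have hp := p.hasFPowerSeriesOnBall (lt_of_lt_of_le (by simpa using hρ) hr)
  convert! hp.analyticAt using 1
  ext x
  exact (FormalMultilinearSeries.ofScalars_sum_eq B x).symm

lemma iteratedDeriv_rpow_expansion {f Q : ℝ → ℝ} {a : ℝ} {A : ℕ → ℝ} {K : ℕ}
    (ha : a ∈ Ioo (-1 : ℝ) 0) (hQ : AnalyticAt ℝ Q 0)
    (hf : ∀ᶠ x in 𝓝[>] (0 : ℝ),
      f x = ∑ i ∈ Finset.range K, A i * x ^ (a + i) + x ^ (a + K) * Q x) (j : ℕ) :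
    ∃ R : ℝ → ℝ, AnalyticAt ℝ R 0 ∧ ∀ᶠ x in 𝓝[>] (0 : ℝ), iteratedDeriv j f x =
      ∑ i ∈ Finset.range K,
        A i * (Real.Gamma (a + i + 1) / Real.Gamma (a + i - j + 1)) * x ^ (a + i - j) +
        x ^ (a + K - j) * R x := by
  induction j with
  | zero =>
    refine ⟨Q, hQ, ?_⟩
    filter_upwards [hf] with x hx
    have hG (i : ℕ) : Real.Gamma (a + i + 1) ≠ 0 :=
      (Real.Gamma_pos_of_pos (by linarith [ha.1, Nat.cast_nonneg (α := ℝ) i])).ne'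
    simp [hx, hG]
  | succ j ih =>
    obtain ⟨R, hR, h⟩ := ih
    refine ⟨fun x => (a + K - j) * R x + x * deriv R x, by fun_prop, ?_⟩
    filter_upwards [eventually_eventually_nhdsWithin.2 h, self_mem_nhdsWithin,
      nhdsWithin_le_nhds hR.eventually_analyticAt] with x hx hx0 hRx
    rw [isOpen_Ioi.nhdsWithin_eq hx0] at hx
    have hx0 : 0 < x := hx0
    rw [iteratedDeriv_succ, EventuallyEq.deriv_eq hx]
    have hpow (b : ℝ) : HasDerivAt (fun y : ℝ => y ^ b) (b * x ^ (b - 1)) x :=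
      Real.hasDerivAt_rpow_const (Or.inl hx0.ne')
    refine ((HasDerivAt.fun_sum fun i _ => (hpow _).const_mul _).add
      ((hpow _).mul hRx.differentiableAt.hasDerivAt)).deriv.trans ?_
    congr 1
    · refine Finset.sum_congr rfl fun i _ => ?_
      have hne : a + i - j ≠ 0 := by
        intro h0
        have h1 : ((-1 : ℤ) : ℝ) < ((j - i : ℤ) : ℝ) := by push_cast; linarith [ha.1]
        have h2 : ((j - i : ℤ) : ℝ) < ((0 : ℤ) : ℝ) := by push_cast; linarith [ha.2]
        rw [Int.cast_lt] at h1 h2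
        omega
      rw [Real.Gamma_add_one hne]
      push_cast
      rw [show a + i - (j + 1 : ℝ) + 1 = a + i - j by ring,
        show a + i - (j + 1 : ℝ) = a + i - j - 1 by ring]
      field_simp
    · have : x ^ (a + K - j) = x ^ (a + K - j - 1) * x := by
        rw [← Real.rpow_add_one hx0.ne']; congr 1; ring
      push_cast
      rw [show a + K - (j + 1 : ℝ) = a + K - j - 1 by ring, this]
      ring

/-- Splitting off the first `K` terms of a convergent power series. -/
lemma exists_analyticAt_rpow_mul_tsum {a ε : ℝ} {A : ℕ → ℝ} (hε : 0 < ε)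
    (hsum : ∀ x ∈ Ioo (-ε) ε, Summable fun n => A n * x ^ n) (K : ℕ) :
    ∃ Q : ℝ → ℝ, AnalyticAt ℝ Q 0 ∧ ∀ x ∈ Ioo (0 : ℝ) ε, x ^ a * ∑' n, A n * x ^ n =
      ∑ i ∈ Finset.range K, A i * x ^ (a + i) + x ^ (a + K) * Q x := by
  refine ⟨fun x => ∑' n, A (n + K) * x ^ n,
    analyticAt_tsum_mul_pow (ρ := ε / 2) (by positivity) ?_, fun x hx => ?_⟩
  · have h := (summable_nat_add_iff K).2 (hsum (ε / 2) ⟨by linarith, by linarith⟩)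
    refine (h.mul_right ((ε / 2) ^ K)⁻¹).congr fun n => ?_
    rw [pow_add]
    field_simp
  · rw [← (hsum x ⟨by linarith [hx.1], hx.2⟩).sum_add_tsum_nat_add K, mul_add, Finset.mul_sum,
      ← tsum_mul_left, ← tsum_mul_left]
    congr 1
    · refine Finset.sum_congr rfl fun i _ => ?_
      rw [Real.rpow_add_natCast hx.1.ne']
      ring
    · refine tsum_congr fun n => ?_
      rw [Real.rpow_add_natCast hx.1.ne']
      ring

lemma exists_summable_bound_iteratedDeriv {F : ℝ → ℝ}
    (hsmooth : ContDiffOn ℝ (⊤ : ℕ∞) F (Ioi 0)) (n : ℕ)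
    (hdecay : ∃ x₀ > (0 : ℝ), ∃ H : ℝ → ℝ, AntitoneOn H (Ioi x₀) ∧ IntegrableOn H (Ioi x₀) ∧
      ∀ x : ℝ, x₀ < |x| → |iteratedDeriv n F x| ≤ H |x|) :
    ∃ u : ℕ → ℝ, Summable u ∧
      ∀ k : ℕ, ∀ y ∈ Ioo (-1 / 2 : ℝ) (1 / 2), ‖iteratedDeriv n F (y + (k + 1))‖ ≤ u k := by
  obtain ⟨x₀, hx₀, H, hanti, hHint, hH⟩ := hdecay
  obtain ⟨N, hN⟩ := exists_nat_gt x₀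
  have hH' (x : ℝ) (hx : x₀ < x) : |iteratedDeriv n F x| ≤ H x := by
    simpa [abs_of_pos (hx₀.trans hx)] using hH x (by rwa [abs_of_pos (hx₀.trans hx)])
  have hsummable : Summable fun k : ℕ => H k :=
    AntitoneOn.summable_of_integrableOn_Ioi (N := N) (hanti.mono fun x hx => hN.trans_le hx)
      (hHint.mono_set (Ioi_subset_Ioi hN.le))
      fun t ht => (abs_nonneg _).trans (hH' t (hN.trans ht))
  have hC (k : ℕ) : ∃ C : ℝ, ∀ x ∈ Icc (k + 1 / 2 : ℝ) (k + 3 / 2),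
      ‖iteratedDeriv n F x‖ ≤ C := by
    refine isCompact_Icc.exists_bound_of_continuousOn fun x hx => ?_
    have : (0 : ℝ) < x := lt_of_lt_of_le (by positivity) hx.1
    exact (hsmooth.hasDerivAt_iteratedDeriv isOpen_Ioi n this).continuousAt.continuousWithinAt
  choose C hC using hC
  refine ⟨fun k => if k < N then C k else H k, ?_, fun k y hy => ?_⟩
  · rw [← summable_nat_add_iff N]
    simpa using (summable_nat_add_iff N).2 hsummable
  · obtain ⟨hy1, hy2⟩ := hy
    beta_reduce
    split_ifs with hk
    · exact hC k _ ⟨by linarith, by linarith⟩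
    · have hk' : x₀ < k := hN.trans_le (by exact_mod_cast not_lt.1 hk)
      have hlt : (k : ℝ) < y + (k + 1) := by linarith
      exact (hH' _ (hk'.trans hlt)).trans (hanti hk' (hk'.trans hlt) hlt.le)

lemma tsum_int_eq_add_tsum_nat {F : ℝ → ℝ} (hsupp : ∀ x ≤ (0 : ℝ), F x = 0) {x : ℝ} (hx : x < 1)
    (hs : Summable fun k : ℕ => F (x + (k + 1))) :
    ∑' k : ℤ, F (x + k) = F x + ∑' k : ℕ, F (x + (k + 1)) := by
  have h1 : HasSum (fun k : ℕ => F (x + ((k : ℤ) : ℝ))) (F x + ∑' k : ℕ, F (x + (k + 1))) := by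
    have h := hs.hasSum
    rw [add_comm (F x)]
    simpa using (hasSum_nat_add_iff (f := fun k : ℕ => F (x + k)) 1).1 (by simpa using h)
  have h2 : HasSum (fun k : ℕ => F (x + ((-(k + 1 : ℤ) : ℤ) : ℝ))) 0 := by
    convert hasSum_zero with k
    apply hsupp
    push_cast
    linarith [Nat.cast_nonneg (α := ℝ) k]
  rw [(HasSum.of_nat_of_neg_add_one (f := fun k : ℤ => F (x + k)) h1 h2).tsum_eq, add_zero]

lemma tendsto_iteratedDeriv_jump {F : ℝ → ℝ} {a : ℝ} (ha : a ∈ Ioo (-1 : ℝ) 0)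
    {A : ℕ → ℝ} {ε : ℝ} (hε : 0 < ε) (hsupp : ∀ x ≤ (0 : ℝ), F x = 0)
    (hsmooth : ContDiffOn ℝ (⊤ : ℕ∞) F (Ioi 0))
    (hdecay : ∀ n : ℕ, ∃ x₀ > (0 : ℝ), ∃ H : ℝ → ℝ,
      AntitoneOn H (Ioi x₀) ∧ IntegrableOn H (Ioi x₀) ∧
      ∀ x : ℝ, x₀ < |x| → |iteratedDeriv n F x| ≤ H |x|)
    (hsum : ∀ x ∈ Ioo (-ε) ε, Summable fun n => A n * x ^ n)
    (hF : ∀ x ∈ Ioo (0 : ℝ) ε, F x = x ^ a * ∑' n, A n * x ^ n)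
    {W : ℝ → ℝ} (hW : ∀ x, W x = ∑' k : ℤ, F (x + (k : ℝ))) (k : ℕ) :
    Tendsto (fun x : ℝ =>
        x ^ (-a) * (iteratedDeriv k W x - iteratedDeriv k W (-x)) -
          ∑ r ∈ Finset.Icc 1 k, A (k - r) *
            (Real.Gamma ((k : ℝ) + a - (r : ℝ) + 1) /
              Real.Gamma (a - (r : ℝ) + 1)) * x ^ (-(r : ℝ)))
      (𝓝[>] 0) (𝓝 (Real.Gamma ((k : ℝ) + 1 + a) / Real.Gamma (1 + a) * A k)) := by
  choose u hu hFu using fun n => exists_summable_bound_iteratedDeriv hsmooth n (hdecay n)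
  set I := Ioo (-1 / 2 : ℝ) (1 / 2)
  let G : ℕ → ℝ → ℝ := fun n y => ∑' i : ℕ, iteratedDeriv n F (y + (i + 1))
  have hGsum (n : ℕ) (y : ℝ) (hy : y ∈ I) :
      Summable fun i : ℕ => iteratedDeriv n F (y + (i + 1)) :=
    .of_norm_bounded (hu n) fun i => hFu n i y hy
  have hG (n : ℕ) (y : ℝ) (hy : y ∈ I) : HasDerivAt (G n) (G (n + 1) y) y := by
    refine hasDerivAt_tsum_of_isPreconnected (hu (n + 1)) isOpen_Ioo isPreconnected_Ioo
      (fun i z hz => ?_) (fun i z hz => hFu (n + 1) i z hz) hy (hGsum n y hy) hy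
    refine HasDerivAt.comp_add_const z _
      (hsmooth.hasDerivAt_iteratedDeriv isOpen_Ioi n (mem_Ioi.2 ?_))
    linarith [hz.1, Nat.cast_nonneg (α := ℝ) i]
  have hW0 (x : ℝ) (hx : x ∈ I) : W x = F x + G 0 x := by
    have := hGsum 0 x hx
    simp only [iteratedDeriv_zero] at this
    simp only [G, iteratedDeriv_zero]
    rw [hW, tsum_int_eq_add_tsum_nat hsupp (by linarith [hx.2]) this]
  have hWneg : EqOn (iteratedDeriv k W) (G k) (Ioo (-1 / 2) 0) :=
    iteratedDeriv_eqOn_of_hasDerivAt isOpen_Ioo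
      (fun x hx => by rw [hW0 x ⟨hx.1, by linarith [hx.2]⟩, hsupp x hx.2.le, zero_add])
      (fun n x hx => hG n x ⟨hx.1, by linarith [hx.2]⟩) k
  have hWpos : EqOn (iteratedDeriv k W) (fun x => iteratedDeriv k F x + G k x)
      (Ioo 0 (1 / 2)) :=
    iteratedDeriv_eqOn_of_hasDerivAt (h := fun n x => iteratedDeriv n F x + G n x) isOpen_Ioo
      (fun x hx => by simpa using hW0 x ⟨by linarith [hx.1], hx.2⟩)
      (fun n x hx => (hsmooth.hasDerivAt_iteratedDeriv isOpen_Ioi n hx.1).add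
        (hG n x ⟨by linarith [hx.1], hx.2⟩)) k
  obtain ⟨Q, hQ, hFQ⟩ := exists_analyticAt_rpow_mul_tsum (a := a) hε hsum (k + 1)
  have hFQ' : ∀ᶠ x in 𝓝[>] (0 : ℝ), F x =
      ∑ i ∈ Finset.range (k + 1), A i * x ^ (a + i) + x ^ (a + (k + 1 : ℕ)) * Q x := by
    filter_upwards [Ioo_mem_nhdsGT hε] with x hx
    rw [hF x hx, hFQ x hx]
  obtain ⟨R, hR, hFR⟩ := iteratedDeriv_rpow_expansion ha hQ hFQ' k
  have hGc : ContinuousAt (G k) 0 := (hG k 0 (by constructor <;> norm_num)).continuousAt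
  have hlim : Tendsto (fun x : ℝ => Real.Gamma (k + 1 + a) / Real.Gamma (1 + a) * A k +
      x * R x + x ^ (-a) * (G k x - G k (-x))) (𝓝[>] 0)
      (𝓝 (Real.Gamma (k + 1 + a) / Real.Gamma (1 + a) * A k)) := by
    have hGneg : ContinuousAt (fun x => G k (-x)) 0 :=
      ContinuousAt.comp' (by simpa using hGc) continuousAt_neg
    have hc : ContinuousAt (fun x : ℝ => Real.Gamma (k + 1 + a) / Real.Gamma (1 + a) * A k +
        x * R x + x ^ (-a) * (G k x - G k (-x))) 0 := by
      refine ((continuousAt_const.add (continuousAt_id.mul hR.continuousAt)).add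
        ((Real.continuousAt_rpow_const 0 (-a) (Or.inr (by linarith [ha.2]))).mul
          (hGc.sub hGneg)))
    have := hc.tendsto
    simp only [zero_mul, add_zero, neg_zero, sub_self, mul_zero] at this
    exact this.mono_left nhdsWithin_le_nhds
  refine hlim.congr' ?_
  filter_upwards [hFR, Ioo_mem_nhdsGT (show (0 : ℝ) < 1 / 2 by norm_num)] with x hx hx2
  rw [hWpos hx2, hWneg ⟨by linarith [hx2.2], by linarith [hx2.1]⟩]
  simp only
  rw [hx, Finset.sum_range_succ]
  have hx0 : 0 < x := hx2.1
  have hreflect : ∑ r ∈ Finset.Icc 1 k, A (k - r) *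
      (Real.Gamma ((k : ℝ) + a - (r : ℝ) + 1) / Real.Gamma (a - (r : ℝ) + 1)) * x ^ (-(r : ℝ)) =
      x ^ (-a) * ∑ i ∈ Finset.range k, A i *
        (Real.Gamma (a + i + 1) / Real.Gamma (a + i - k + 1)) * x ^ (a + i - k) := by
    rw [Finset.mul_sum]
    refine Finset.sum_nbij' (fun r => k - r) (fun i => k - i) ?_ ?_ ?_ ?_ fun r hr => ?_
    any_goals (intro r hr; simp only [Finset.mem_Icc, Finset.mem_range] at hr ⊢; omega)
    rw [Nat.cast_sub (Finset.mem_Icc.1 hr).2, mul_left_comm, ← Real.rpow_add hx0]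
    ring_nf
  have h1 : x ^ (-a) * x ^ (a + k - k) = 1 := by
    rw [← Real.rpow_add hx0]; simp
  have h2 : x ^ (-a) * x ^ (a + (k + 1 : ℕ) - k) = x := by
    rw [← Real.rpow_add hx0]
    push_cast
    ring_nf
    exact Real.rpow_one x
  rw [hreflect, show (k : ℝ) + 1 + a = a + k + 1 by ring, show 1 + a = a + k - k + 1 by ring]
  linear_combination (-(A k * (Real.Gamma (a + k + 1) / Real.Gamma (a + k - k + 1)))) * h1
    - R x * h2

/-- the periodization `W(x) = ∑_{k∈ℤ} F(x+k)` of a function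
`F(x) = x^a·∑ Aₙxⁿ` (near `0⁺`, with `a ∈ (−1,0)`, `F` smooth on `(0,∞)` with all
derivatives decaying sufficiently fast) determines the coefficients `Aₙ` via
one-sided limits at `0`. -/
theorem stmt6 (F : ℝ → ℝ) (a : ℝ) (ha : a ∈ Ioo (-1 : ℝ) 0)
    (A : ℕ → ℝ) (ε : ℝ) (hε : 0 < ε)
    (hsupp : ∀ x ≤ (0:ℝ), F x = 0)
    (hint : IntegrableOn F (Ioi 0))
    (hsmooth : ContDiffOn ℝ (⊤ : ℕ∞) F (Ioi 0))
    (hdecay : ∀ n : ℕ, ∃ x₀ > (0:ℝ), ∃ H : ℝ → ℝ,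
      AntitoneOn H (Ioi x₀) ∧ IntegrableOn H (Ioi x₀) ∧
      ∀ x : ℝ, x₀ < |x| → |iteratedDeriv n F x| ≤ H |x|)
    (hsum : ∀ x ∈ Ioo (-ε) ε, Summable fun n => A n * x ^ n)
    (hF : ∀ x ∈ Ioo (0:ℝ) ε, F x = x ^ a * ∑' n, A n * x ^ n)
    (W : ℝ → ℝ) (hW : ∀ x, W x = ∑' k : ℤ, F (x + (k : ℝ))) :
    Filter.Tendsto (fun x : ℝ => x ^ (-a) * (W x - W (-x)))
      (nhdsWithin 0 (Ioi 0)) (nhds (A 0)) ∧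
    ∀ k : ℕ, 1 ≤ k →
      Filter.Tendsto (fun x : ℝ =>
          x ^ (-a) * (iteratedDeriv k W x - iteratedDeriv k W (-x)) -
            ∑ r ∈ Finset.Icc 1 k, A (k - r) *
              (Real.Gamma ((k : ℝ) + a - (r : ℝ) + 1) /
                Real.Gamma (a - (r : ℝ) + 1)) * x ^ (-(r : ℝ)))
        (nhdsWithin 0 (Ioi 0))
        (nhds (Real.Gamma ((k : ℝ) + 1 + a) / Real.Gamma (1 + a) * A k)) := by
  have key := tendsto_iteratedDeriv_jump ha hε hsupp hsmooth hdecay hsum hF hW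
  refine ⟨?_, fun k _ => key k⟩
  have hG : Real.Gamma (1 + a) ≠ 0 := (Real.Gamma_pos_of_pos (by linarith [ha.1])).ne'
  simpa [hG] using key 0
end

section
/- Let d≥2 be even and let t₁,…,t_d and t′₁,…,t′_d be nonzero reals. Let F and F′ be integrable functions on (0,∞), smooth on (0,∞), such that for some ε>0: F(x)=x^{−1/2}·∑_{n=0}^∞ aₙxⁿ and F′(x)=x^{−1/2}·∑_{n=0}^∞ a′ₙxⁿ for x∈(0,ε), with the power series convergent on (−ε,ε). Assume that for every nonempty subset {s₁,…,s_k}⊆{t₁,…,t_d} whose elements all have the same sign, all derivatives of F_{s₁}*⋯*F_{s_k} decay sufficiently fast (and likewise for F′ with subsets of {t′₁,…,t′_d}), and that all derivatives of F_{t₁}*⋯*F_{t_d} and of F′_{t′₁}*⋯*F′_{t′_d} decay sufficiently fast. Define Aₙ = (1/√|t₁⋯t_d|)·(1/Γ(n+d/2))·∑_{k₁+⋯+k_d=n} ∏_{i=1}^d a_{k_i}·Γ(k_i+1/2)/t_i^{k_i}, and A′ₙ analogously from a′,t′. If ∑_{k∈ℤ}(F_{t₁}*⋯*F_{t_d})(x+k)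 = ∑_{k∈ℤ}(F′_{t′₁}*⋯*F′_{t′_d})(x+k) for all x∈(−1/2,1/2)∖{0}, then either Aₙ=A′ₙ for all n≥0, or Aₙ=−A′ₙ for all n≥0. -/
open MeasureTheory Set

/-- Convolution of two real functions. -/
noncomputable def conv (F G : ℝ → ℝ) : ℝ → ℝ := fun x => ∫ y, F y * G (x - y)

/-- Iterated convolution of a list of functions. -/
noncomputable def multiConv : List (ℝ → ℝ) → (ℝ → ℝ)
  | [] => fun _ => 0
  | [f] => f
  | f :: g :: fs => conv f (multiConv (g :: fs))

/-- The rescaling `F_t(x) = (1/|t|)·F(x/t)`. -/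
noncomputable def rescale (t : ℝ) (F : ℝ → ℝ) : ℝ → ℝ := fun x => (1 / |t|) * F (x / t)

/-- All the derivatives of `F` decay "sufficiently fast". -/
def DecaysFast (F : ℝ → ℝ) : Prop :=
  ∀ n : ℕ, ∃ x₀ > (0:ℝ), ∃ H : ℝ → ℝ,
    AntitoneOn H (Set.Ioi x₀) ∧ MeasureTheory.IntegrableOn H (Set.Ioi x₀) ∧
    ∀ x : ℝ, x₀ < |x| → |iteratedDeriv n F x| ≤ H |x|

section

open Filter Topology FourierTransform

theorem summable_derivative_of_summable {b : ℕ → ℝ} {ε : ℝ}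
    (hb : ∀ x ∈ Ioo (-ε) ε, Summable fun n => b n * x ^ n) {r : ℝ} (hr : 0 < r) (hrε : r < ε) :
    ∃ u : ℕ → ℝ, Summable u ∧ ∀ n, ∀ x ∈ Ioo (-r) r, ‖b n * (n * x ^ (n - 1))‖ ≤ u n := by
  obtain ⟨ρ, hrρ, hρε⟩ := exists_between hrε
  have hρ : 0 < ρ := hr.trans hrρ
  obtain ⟨C, hC⟩ := ((hb ρ ⟨by linarith, hρε⟩).tendsto_atTop_zero.norm.bddAbove_range)
  have hC' : ∀ n, |b n| * ρ ^ n ≤ C := fun n => by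
    have := hC ⟨n, rfl⟩
    simpa [abs_mul, abs_of_pos hρ] using this
  have hq : ‖r / ρ‖ < 1 := by
    rw [Real.norm_of_nonneg (by positivity), div_lt_one hρ]; exact hrρ
  refine ⟨fun n => C / r * ((n : ℝ) ^ 1 * (r / ρ) ^ n),
    (summable_pow_mul_geometric_of_norm_lt_one 1 hq).mul_left _, fun n x hx => ?_⟩
  rcases n with _ | n
  · simp
  have hx' : |x| ≤ r := (abs_lt.2 hx).le
  have h1 : |b (n + 1)| ≤ C / ρ ^ (n + 1) := by
    rw [le_div_iff₀ (by positivity)]; exact hC' _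
  have h2 : |x| ^ n ≤ r ^ n := by gcongr
  calc ‖b (n + 1) * (((n + 1 : ℕ) : ℝ) * x ^ (n + 1 - 1))‖
      = |b (n + 1)| * (((n + 1 : ℕ) : ℝ) * |x| ^ n) := by
        simp only [norm_mul, norm_pow, Real.norm_eq_abs, Nat.abs_cast, Nat.add_sub_cancel]
    _ ≤ C / ρ ^ (n + 1) * (((n + 1 : ℕ) : ℝ) * r ^ n) := by
        gcongr
        exact (abs_nonneg _).trans h1
    _ = _ := by
        simp only [div_pow]; field_simp; ring

theorem hasDerivAt_tsum_mul_pow {b : ℕ → ℝ} {ε : ℝ}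
    (hb : ∀ x ∈ Ioo (-ε) ε, Summable fun n => b n * x ^ n) {x : ℝ} (hx : x ∈ Ioo (-ε) ε) :
    (Summable fun n => b n * (n * x ^ (n - 1))) ∧
    HasDerivAt (fun y => ∑' n, b n * y ^ n) (∑' n, b n * (n * x ^ (n - 1))) x := by
  obtain ⟨r, hxr, hrε⟩ := exists_between (abs_lt.2 hx)
  have hr : 0 < r := (abs_nonneg x).trans_lt hxr
  obtain ⟨u, hu, hbu⟩ := summable_derivative_of_summable hb hr hrε
  have hxr' : x ∈ Ioo (-r) r := abs_lt.1 hxr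
  refine ⟨Summable.of_norm_bounded hu fun n => hbu n x hxr', ?_⟩
  refine hasDerivAt_tsum_of_isPreconnected hu isOpen_Ioo isPreconnected_Ioo
    (fun n y _ => ?_) hbu hxr' (hb x hx) hxr'
  exact (hasDerivAt_pow n y).const_mul (b n)

theorem summable_shift {a : ℕ → ℝ} {ε : ℝ}
    (ha : ∀ x ∈ Ioo (-ε) ε, Summable fun n => a n * x ^ n) :
    ∀ x ∈ Ioo (-ε) ε, Summable fun n => a (n + 1) * x ^ n := by
  intro x hx
  rcases eq_or_ne x 0 with rfl | h0
  · refine summable_of_ne_finset_zero (s := {0}) fun n hn => ?_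
    simp at hn
    simp [hn]
  · have := ((summable_nat_add_iff 1).2 (ha x hx)).mul_right x⁻¹
    refine this.congr fun n => ?_
    field_simp
    ring

/-- `f` has a convergent expansion `x ^ (-1/2) * ∑ aₙ xⁿ` on `(0, ε)`, is infinitely
differentiable on `(0, ∞)`, and all of its derivatives are integrable away from the origin. -/
structure HalfPowerExpansion (f : ℝ → ℝ) (a : ℕ → ℝ) (ε : ℝ) : Prop where
  pos : 0 < ε
  summable : ∀ x ∈ Ioo (-ε) ε, Summable fun n => a n * x ^ n
  eq_near_zero : ∀ x ∈ Ioo (0 : ℝ) ε, f x = x ^ (-(1 : ℝ) / 2) * ∑' n, a n * x ^ n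
  exists_derivs : ∃ g : ℕ → ℝ → ℝ, g 0 = f ∧
    (∀ n, ∀ x > 0, HasDerivAt (g n) (g (n + 1) x) x) ∧ ∀ n, ∀ c > 0, IntegrableOn (g n) (Ioi c)

namespace HalfPowerExpansion

variable {f : ℝ → ℝ} {a : ℕ → ℝ} {ε : ℝ}

theorem integrableOn (hf : HalfPowerExpansion f a ε) : IntegrableOn f (Ioi 0) := by
  obtain ⟨g, hg0, -, hgi⟩ := hf.exists_derivs
  have hε := hf.pos
  have h2 : 0 < ε / 2 := by linarith
  rw [← Ioc_union_Ioi_eq_Ioi h2.le]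
  refine IntegrableOn.union ?_ (hg0 ▸ hgi 0 _ h2)
  have h1 : IntegrableOn (fun x : ℝ => x ^ (-(1 : ℝ) / 2)) (Ioc 0 (ε / 2)) := by
    rw [← intervalIntegrable_iff_integrableOn_Ioc_of_le h2.le]
    exact intervalIntegral.intervalIntegrable_rpow' (by norm_num)
  have hc : ContinuousOn (fun x : ℝ => ∑' n, a n * x ^ n) (Icc 0 (ε / 2)) := fun x hx =>
    (hasDerivAt_tsum_mul_pow hf.summable
      ⟨by linarith [hx.1], by linarith [hx.2]⟩).2.continuousAt.continuousWithinAt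
  refine (h1.mul_continuousOn_of_subset hc measurableSet_Ioc isCompact_Icc
    Ioc_subset_Icc_self).congr_fun (fun x hx => ?_) measurableSet_Ioc
  exact (hf.eq_near_zero x ⟨hx.1, by linarith [hx.2]⟩).symm

/-- Near the origin, `f` minus its leading term is `x ^ (1/2)` times a power series. -/
theorem sub_leading_eq (hf : HalfPowerExpansion f a ε) {x : ℝ} (hx : x ∈ Ioo 0 ε) :
    f x - a 0 * x ^ (-(1 : ℝ) / 2) = x ^ ((1 : ℝ) / 2) * ∑' n, a (n + 1) * x ^ n := by
  have hx' : x ∈ Ioo (-ε) ε := ⟨by linarith [hx.1, hf.pos], hx.2⟩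
  rw [hf.eq_near_zero x hx, (hf.summable x hx').tsum_eq_zero_add]
  have h1 : ∑' n, a (n + 1) * x ^ (n + 1) = x * ∑' n, a (n + 1) * x ^ n := by
    rw [← tsum_mul_left]
    exact tsum_congr fun n => by ring
  have h2 : x ^ ((1 : ℝ) / 2) = x ^ (-(1 : ℝ) / 2) * x := by
    conv_rhs => rw [← Real.rpow_one x, ← Real.rpow_mul hx.1.le, ← Real.rpow_add hx.1]
    norm_num
  rw [h1, h2]
  ring

/-- The derivative of `f` minus its leading term. -/
theorem hasDerivAt_sub_leading (f' : ℝ) {x : ℝ} (c : ℝ) (hx : 0 < x) (h : HasDerivAt f f' x) :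
    HasDerivAt (fun y => f y - c * y ^ (-(1 : ℝ) / 2)) (f' + c / 2 * x ^ (-(3 : ℝ) / 2)) x := by
  refine (h.sub ((Real.hasDerivAt_rpow_const (p := -(1 : ℝ) / 2)
    (Or.inl hx.ne')).const_mul c)).congr_deriv ?_
  rw [show -(1 : ℝ) / 2 - 1 = -3 / 2 by norm_num]
  ring

theorem exists_rpow_derivs (c s : ℝ) (hs : s < -1) : ∃ g : ℕ → ℝ → ℝ,
    g 0 = (fun x => c * x ^ s) ∧
    (∀ n, ∀ x > 0, HasDerivAt (g n) (g (n + 1) x) x) ∧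
    ∀ n, ∀ c > 0, IntegrableOn (g n) (Ioi c) := by
  let k : ℕ → ℝ := fun n => Nat.rec c (fun n y => y * (s - n)) n
  refine ⟨fun n x => k n * x ^ (s - n), ?_, ?_, ?_⟩
  · simp [k]
  · intro n x hx
    refine ((Real.hasDerivAt_rpow_const (p := s - n) (Or.inl hx.ne')).const_mul (k n)).congr_deriv ?_
    change _ = k n * (s - n) * x ^ (s - (n + 1 : ℕ))
    push_cast
    rw [sub_sub, mul_assoc]
  · intro n c hc
    refine (integrableOn_Ioi_rpow_of_lt ?_ hc).const_mul _
    have : (0 : ℝ) ≤ n := n.cast_nonneg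
    linarith

/-- Derivative of `f` minus its leading term again has a half-power expansion. -/
theorem exists_deriv (hf : HalfPowerExpansion f a ε) : ∃ h : ℝ → ℝ,
    HalfPowerExpansion h (fun k => a (k + 1) * (k + 1 / 2)) ε ∧
    ∀ x > 0, HasDerivAt (fun y => f y - a 0 * y ^ (-(1 : ℝ) / 2)) (h x) x := by
  obtain ⟨g, hg0, hgd, hgi⟩ := hf.exists_derivs
  obtain ⟨q, hq0, hqd, hqi⟩ := exists_rpow_derivs (a 0 / 2) (-(3 : ℝ) / 2) (by norm_num)
  have key : ∀ x > 0, HasDerivAt (fun y => f y - a 0 * y ^ (-(1 : ℝ) / 2)) ((g 1 + q 0) x) x := by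
    intro x hx
    have := hasDerivAt_sub_leading _ (a 0) hx (hg0 ▸ hgd 0 x hx)
    simpa [hq0] using this
  have hsh := summable_shift hf.summable
  have hterm : ∀ (n : ℕ) (x : ℝ), a (n + 1) * (n + 1 / 2) * x ^ n =
      x * (a (n + 1) * (n * x ^ (n - 1))) + 1 / 2 * (a (n + 1) * x ^ n) := by
    intro n x
    rcases n with _ | n
    · simp; ring
    · simp only [Nat.add_sub_cancel]; ring
  refine ⟨g 1 + q 0, ⟨hf.pos, ?_, ?_, fun n => g (n + 1) + q n, rfl, ?_, ?_⟩, key⟩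
  · intro x hx
    simp only [hterm]
    exact ((hasDerivAt_tsum_mul_pow hsh hx).1.mul_left x).add ((hsh x hx).mul_left _)
  · intro x hx
    have hx' : x ∈ Ioo (-ε) ε := ⟨by linarith [hx.1, hf.pos], hx.2⟩
    obtain ⟨hs, hd⟩ := hasDerivAt_tsum_mul_pow hsh hx'
    have hd2 := (Real.hasDerivAt_rpow_const (p := (1 : ℝ) / 2) (Or.inl hx.1.ne')).mul hd
    have heq : (fun y => f y - a 0 * y ^ (-(1 : ℝ) / 2)) =ᶠ[𝓝 x]
        fun y => y ^ ((1 : ℝ) / 2) * ∑' n, a (n + 1) * y ^ n := by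
      filter_upwards [isOpen_Ioo.mem_nhds hx] with y hy using hf.sub_leading_eq hy
    rw [(key x hx.1).unique (hd2.congr_of_eventuallyEq heq)]
    simp only [hterm]
    rw [(hs.mul_left x).tsum_add ((hsh x hx').mul_left _), tsum_mul_left, tsum_mul_left]
    have h2 : x ^ ((1 : ℝ) / 2) = x ^ (-(1 : ℝ) / 2) * x := by
      conv_rhs => rw [← Real.rpow_one x, ← Real.rpow_mul hx.1.le, ← Real.rpow_add hx.1]
      norm_num
    rw [h2, show (1 : ℝ) / 2 - 1 = -1 / 2 by norm_num]
    ring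
  · exact fun n x hx => (hgd (n + 1) x hx).add (hqd n x hx)
  · exact fun n c hc => (hgi (n + 1) c hc).add (hqi n c hc)

theorem tendsto_sub_leading_zero (hf : HalfPowerExpansion f a ε) :
    Tendsto (fun y => f y - a 0 * y ^ (-(1 : ℝ) / 2)) (𝓝[>] 0) (𝓝 0) := by
  have hc := (hasDerivAt_tsum_mul_pow (summable_shift hf.summable)
    (x := 0) ⟨by linarith [hf.pos], hf.pos⟩).2.continuousAt.tendsto
  have h1 : Tendsto (fun y : ℝ => y ^ ((1 : ℝ) / 2)) (𝓝 0) (𝓝 0) := by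
    have := (Real.continuous_rpow_const (q := (1 : ℝ) / 2) (by norm_num)).tendsto 0
    rwa [Real.zero_rpow (by norm_num)] at this
  have := (h1.mul hc).mono_left (nhdsWithin_le_nhds (s := Ioi 0))
  rw [zero_mul] at this
  refine this.congr' ?_
  filter_upwards [Ioo_mem_nhdsGT hf.pos] with y hy using (hf.sub_leading_eq hy).symm

theorem tendsto_sub_leading_atTop (hf : HalfPowerExpansion f a ε) :
    Tendsto (fun y => f y - a 0 * y ^ (-(1 : ℝ) / 2)) atTop (𝓝 0) := by
  obtain ⟨g, hg0, hgd, hgi⟩ := hf.exists_derivs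
  have h1 : Tendsto f atTop (𝓝 0) := by
    rw [← hg0]
    exact tendsto_zero_of_hasDerivAt_of_integrableOn_Ioi (a := 1)
      (fun x hx => hgd 0 x (zero_lt_one.trans hx)) (hgi 1 1 one_pos) (hgi 0 1 one_pos)
  have h2 : Tendsto (fun y : ℝ => y ^ (-(1 : ℝ) / 2)) atTop (𝓝 0) := by
    have := tendsto_rpow_neg_atTop (y := 1 / 2) (by norm_num)
    simpa [neg_div] using this
  simpa using h1.sub (h2.const_mul (a 0))

end HalfPowerExpansion

/-- The Laplace transform of `f` on the half-line `(0, ∞)`. -/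
noncomputable def halfLaplace (f : ℝ → ℝ) (p : ℂ) : ℂ :=
  ∫ x in Ioi (0 : ℝ), (f x : ℂ) * Complex.exp (-(p * x))

theorem norm_exp_neg_mul_ofReal_le {p : ℂ} (hp : 0 ≤ p.re) {x : ℝ} (hx : 0 < x) :
    ‖Complex.exp (-(p * x))‖ ≤ 1 := by
  rw [Complex.norm_exp, Real.exp_le_one_iff]
  simp only [Complex.neg_re, Complex.re_mul_ofReal]
  nlinarith

theorem integrableOn_halfLaplace {f : ℝ → ℝ} (hf : IntegrableOn f (Ioi 0)) {p : ℂ}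
    (hp : 0 ≤ p.re) :
    IntegrableOn (fun x : ℝ => (f x : ℂ) * Complex.exp (-(p * x))) (Ioi 0) := by
  refine hf.ofReal.mul_bdd (c := 1) (by fun_prop) ?_
  filter_upwards [ae_restrict_mem measurableSet_Ioi] with x hx
  exact norm_exp_neg_mul_ofReal_le hp hx

theorem norm_halfLaplace_le {f : ℝ → ℝ} (hf : IntegrableOn f (Ioi 0)) {p : ℂ} (hp : 0 ≤ p.re) :
    ‖halfLaplace f p‖ ≤ ∫ x in Ioi (0 : ℝ), ‖f x‖ := by
  refine norm_integral_le_of_norm_le hf.norm ?_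
  filter_upwards [ae_restrict_mem measurableSet_Ioi] with x hx
  rw [norm_mul, Complex.norm_real]
  exact mul_le_of_le_one_right (norm_nonneg _) (norm_exp_neg_mul_ofReal_le hp hx)

theorem tendsto_halfLaplace {f : ℝ → ℝ} (hf : IntegrableOn f (Ioi 0)) (z : ℝ) :
    Tendsto (fun δ : ℝ => halfLaplace f (δ + z * Complex.I)) (𝓝[>] 0)
      (𝓝 (halfLaplace f (z * Complex.I))) := by
  refine tendsto_integral_filter_of_dominated_convergence (fun x => ‖f x‖) ?_ ?_ hf.norm ?_
  · filter_upwards [self_mem_nhdsWithin] with δ hδ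
    exact (integrableOn_halfLaplace hf (by simpa using hδ.le)).aestronglyMeasurable
  · filter_upwards [self_mem_nhdsWithin] with δ hδ
    filter_upwards [ae_restrict_mem measurableSet_Ioi] with x hx
    rw [norm_mul, Complex.norm_real]
    exact mul_le_of_le_one_right (norm_nonneg _)
      (norm_exp_neg_mul_ofReal_le (by simpa using hδ.le) hx)
  · refine ae_of_all _ fun x => ?_
    have : Continuous fun δ : ℝ => (f x : ℂ) * Complex.exp (-((δ + z * Complex.I) * x)) := by
      fun_prop
    simpa using (this.tendsto 0).mono_left nhdsWithin_le_nhds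

theorem ofReal_mul_cpow {r : ℝ} (hr : 0 < r) (z w : ℂ) :
    ((r : ℂ) * z) ^ w = (r : ℂ) ^ w * z ^ w := by
  have hr' : (r : ℂ) ≠ 0 := by exact_mod_cast hr.ne'
  rcases eq_or_ne z 0 with rfl | hz
  · rcases eq_or_ne w 0 with rfl | hw
    · simp
    · simp [Complex.zero_cpow hw]
  · rw [Complex.cpow_def_of_ne_zero (mul_ne_zero hr' hz), Complex.cpow_def_of_ne_zero hr',
      Complex.cpow_def_of_ne_zero hz, Complex.log_ofReal_mul hr hz, add_mul, Complex.exp_add,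
      Complex.ofReal_log hr.le]

theorem integrableOn_rpow_neg_half_mul_exp {p : ℂ} (hp : 0 < p.re) :
    IntegrableOn (fun x : ℝ => ((x ^ (-(1 : ℝ) / 2) : ℝ) : ℂ) * Complex.exp (-(p * x)))
      (Ioi 0) := by
  have h := integrableOn_rpow_mul_exp_neg_mul_rpow (s := -(1 : ℝ) / 2) (p := 1) (b := p.re)
    (by norm_num) one_pos hp
  refine Integrable.mono' h ?_ ?_
  · refine AEStronglyMeasurable.mul ?_ (by fun_prop)
    exact (Complex.measurable_ofReal.comp (by fun_prop)).aestronglyMeasurable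
  · filter_upwards [ae_restrict_mem measurableSet_Ioi] with x hx
    rw [norm_mul, Complex.norm_real, Complex.norm_exp,
      Real.norm_of_nonneg (Real.rpow_nonneg (le_of_lt hx) _)]
    simp

theorem halfLaplace_rpow_neg_half {p : ℂ} (hp : 0 < p.re) :
    halfLaplace (fun x => x ^ (-(1 : ℝ) / 2)) p = Real.Gamma (1 / 2) * p ^ (-(1 / 2) : ℂ) := by
  have hp0 : p ≠ 0 := by rintro rfl; simp at hp
  have harg : p.arg ≠ Real.pi := by
    intro h
    have := Complex.arg_eq_pi_iff.1 h
    linarith [this.1]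
  unfold halfLaplace
  rw [← integral_comp_rpow_Ioi_of_pos (two_pos : (0 : ℝ) < 2)]
  have : ∀ x ∈ Ioi (0 : ℝ), ((2 : ℝ) * x ^ ((2 : ℝ) - 1)) •
      ((((x ^ (2 : ℝ)) ^ (-(1 : ℝ) / 2) : ℝ) : ℂ) * Complex.exp (-(p * (x ^ (2 : ℝ) : ℝ)))) =
      2 * Complex.exp (-p * (x : ℂ) ^ 2) := by
    intro x hx
    have hx0 : (x : ℂ) ≠ 0 := by exact_mod_cast (ne_of_gt hx)
    rw [← Real.rpow_mul (le_of_lt hx), Real.rpow_two]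
    norm_num
    rw [Real.rpow_neg_one]
    push_cast
    field_simp
  rw [setIntegral_congr_fun measurableSet_Ioi this, integral_const_mul,
    integral_gaussian_complex_Ioi hp, div_eq_mul_inv (Real.pi : ℂ), ofReal_mul_cpow Real.pi_pos,
    Complex.inv_cpow _ _ harg, Complex.cpow_neg, Real.Gamma_one_half_eq, Real.sqrt_eq_rpow,
    Complex.ofReal_cpow Real.pi_pos.le]
  push_cast
  ring

namespace HalfPowerExpansion

variable {f : ℝ → ℝ} {a : ℕ → ℝ} {ε : ℝ}

theorem halfLaplace_eq_of_re_pos (hf : HalfPowerExpansion f a ε) {h : ℝ → ℝ}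
    (hh : IntegrableOn h (Ioi 0))
    (hd : ∀ x > 0, HasDerivAt (fun y => f y - a 0 * y ^ (-(1 : ℝ) / 2)) (h x) x)
    {p : ℂ} (hp : 0 < p.re) :
    halfLaplace f p =
      a 0 * Real.Gamma (1 / 2) * p ^ (-(1 / 2) : ℂ) + p⁻¹ * halfLaplace h p := by
  have hp0 : p ≠ 0 := by rintro rfl; simp at hp
  have hi1 := integrableOn_halfLaplace hf.integrableOn hp.le
  have hi2 := integrableOn_rpow_neg_half_mul_exp hp
  let u : ℝ → ℂ := fun x => ((f x - a 0 * x ^ (-(1 : ℝ) / 2) : ℝ) : ℂ)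
  let v : ℝ → ℂ := fun x => Complex.exp (-(p * x))
  have hv : ∀ x : ℝ, HasDerivAt v (-p * Complex.exp (-(p * x))) x := by
    intro x
    have h1 : HasDerivAt (fun y : ℂ => Complex.exp (-(p * y))) _ (x : ℂ) :=
      ((hasDerivAt_id (x : ℂ)).const_mul p).neg.cexp
    refine h1.comp_ofReal.congr_deriv ?_
    simp only [Pi.neg_apply, id]
    ring
  have hu : ∀ x ∈ Ioi (0 : ℝ), HasDerivAt u (h x : ℂ) x := fun x hx => (hd x hx).ofReal_comp
  have hvb : ∀ᶠ x in 𝓟 (Ioi (0 : ℝ)), ‖v x‖ ≤ 1 :=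
    eventually_principal.2 fun x hx => norm_exp_neg_mul_ofReal_le hp.le hx
  have huv : IntegrableOn (fun x => u x * v x) (Ioi 0) := by
    refine (hi1.sub (hi2.const_mul (a 0 : ℂ))).congr_fun (fun x _ => ?_) measurableSet_Ioi
    simp only [u, v, Pi.sub_apply]
    push_cast
    ring
  have hlim : ∀ l : Filter ℝ, l ≤ 𝓟 (Ioi 0) →
      Tendsto (fun y => f y - a 0 * y ^ (-(1 : ℝ) / 2)) l (𝓝 0) →
      Tendsto (u * v) l (𝓝 0) := by
    intro l hl ht
    have ht' : Tendsto u l (𝓝 0) := by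
      simpa [u, Function.comp_def] using (Complex.continuous_ofReal.tendsto 0).comp ht
    refine ht'.zero_mul_isBoundedUnder_le ⟨1, ?_⟩
    exact eventually_map.2 (hvb.filter_mono hl)
  have hparts := integral_Ioi_mul_deriv_eq_deriv_mul (a := (0 : ℝ)) (u := u) (v := v)
    (u' := fun x => (h x : ℂ)) (v' := fun x => -p * Complex.exp (-(p * x))) hu (fun x _ => hv x)
    (IntegrableOn.congr_fun (huv.const_mul (-p)) (fun x _ => by simp only [u, v, Pi.mul_apply]; ring)
      measurableSet_Ioi)
    (integrableOn_halfLaplace hh hp.le)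
    (hlim _ inf_le_right hf.tendsto_sub_leading_zero)
    (hlim _ (le_principal_iff.2 (Ioi_mem_atTop 0)) hf.tendsto_sub_leading_atTop)
  have e1 : ∫ x in Ioi (0 : ℝ), u x * (-p * Complex.exp (-(p * x))) =
      -p * (halfLaplace f p - a 0 * (Real.Gamma (1 / 2) * p ^ (-(1 / 2) : ℂ))) := by
    rw [← halfLaplace_rpow_neg_half hp]
    unfold halfLaplace
    rw [← integral_const_mul (a 0 : ℂ), ← integral_sub hi1 (hi2.const_mul _), ← integral_const_mul]
    refine integral_congr_ae (ae_of_all _ fun x => ?_)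
    simp only [u]
    push_cast
    ring
  rw [e1] at hparts
  have e2 : ∫ x in Ioi (0 : ℝ), (h x : ℂ) * v x = halfLaplace h p := rfl
  rw [e2] at hparts
  field_simp
  linear_combination -hparts

theorem halfLaplace_eq (hf : HalfPowerExpansion f a ε) {h : ℝ → ℝ}
    (hh : IntegrableOn h (Ioi 0))
    (hd : ∀ x > 0, HasDerivAt (fun y => f y - a 0 * y ^ (-(1 : ℝ) / 2)) (h x) x)
    {z : ℝ} (hz : z ≠ 0) :
    halfLaplace f (z * Complex.I) = a 0 * Real.Gamma (1 / 2) * (z * Complex.I) ^ (-(1 / 2) : ℂ) +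
      (z * Complex.I)⁻¹ * halfLaplace h (z * Complex.I) := by
  have hzI : (z * Complex.I : ℂ) ≠ 0 := by simp [hz]
  have hs : (z * Complex.I : ℂ) ∈ Complex.slitPlane := by
    rw [Complex.mem_slitPlane_iff]; right; simpa using hz
  refine tendsto_nhds_unique (tendsto_halfLaplace hf.integrableOn z) ?_
  have hp : Tendsto (fun δ : ℝ => (δ + z * Complex.I : ℂ)) (𝓝[>] 0) (𝓝 (z * Complex.I)) := by
    have : Continuous fun δ : ℝ => (δ + z * Complex.I : ℂ) := by fun_prop
    simpa using (this.tendsto 0).mono_left nhdsWithin_le_nhds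
  have h1 : Tendsto (fun δ : ℝ => (δ + z * Complex.I : ℂ) ^ (-(1 / 2) : ℂ)) (𝓝[>] 0)
      (𝓝 ((z * Complex.I) ^ (-(1 / 2) : ℂ))) := (continuousAt_cpow_const hs).tendsto.comp hp
  refine ((h1.const_mul (a 0 * Real.Gamma (1 / 2) : ℂ)).add
    ((hp.inv₀ hzI).mul (tendsto_halfLaplace hh z))).congr' ?_
  filter_upwards [self_mem_nhdsWithin] with δ hδ
  exact (hf.halfLaplace_eq_of_re_pos hh hd (by simpa using hδ)).symm

/-- The asymptotic expansion of the Laplace transform along the imaginary axis. -/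
theorem exists_norm_halfLaplace_sub_le (N : ℕ) : ∀ {f : ℝ → ℝ} {a : ℕ → ℝ},
    HalfPowerExpansion f a ε → ∃ C : ℝ, ∀ z : ℝ, z ≠ 0 →
      ‖halfLaplace f (z * Complex.I) - (z * Complex.I) ^ (-(1 / 2) : ℂ) *
        ∑ k ∈ Finset.range N, ((a k * Real.Gamma (k + 1 / 2) : ℝ) : ℂ) / (z * Complex.I) ^ k‖ ≤
      C / |z| ^ N := by
  induction N with
  | zero =>
    intro f a hf
    refine ⟨∫ x in Ioi (0 : ℝ), ‖f x‖, fun z _ => ?_⟩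
    simpa using norm_halfLaplace_le hf.integrableOn (p := z * Complex.I) (by simp)
  | succ N ih =>
    intro f a hf
    obtain ⟨h, hh, hd⟩ := hf.exists_deriv
    obtain ⟨C, hC⟩ := ih hh
    refine ⟨C, fun z hz => ?_⟩
    have hzI : (z * Complex.I : ℂ) ≠ 0 := by simp [hz]
    have hG : ∀ k : ℕ, Real.Gamma ((k + 1 : ℕ) + 1 / 2) =
        (k + 1 / 2) * Real.Gamma (k + 1 / 2) := fun k => by
      rw [← Real.Gamma_add_one (by positivity)]
      push_cast
      congr 1
      ring
    have key : halfLaplace f (z * Complex.I) - (z * Complex.I) ^ (-(1 / 2) : ℂ) *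
        ∑ k ∈ Finset.range (N + 1),
          ((a k * Real.Gamma (k + 1 / 2) : ℝ) : ℂ) / (z * Complex.I) ^ k =
        (z * Complex.I)⁻¹ * (halfLaplace h (z * Complex.I) - (z * Complex.I) ^ (-(1 / 2) : ℂ) *
          ∑ k ∈ Finset.range N,
            ((a (k + 1) * (k + 1 / 2) * Real.Gamma (k + 1 / 2) : ℝ) : ℂ) /
              (z * Complex.I) ^ k) := by
      have hs : ∑ k ∈ Finset.range N,
          ((a (k + 1) * Real.Gamma ((k + 1 : ℕ) + 1 / 2) : ℝ) : ℂ) / (z * Complex.I) ^ (k + 1) =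
          (z * Complex.I)⁻¹ * ∑ k ∈ Finset.range N,
            ((a (k + 1) * (k + 1 / 2) * Real.Gamma (k + 1 / 2) : ℝ) : ℂ) /
              (z * Complex.I) ^ k := by
        rw [Finset.mul_sum]
        refine Finset.sum_congr rfl fun k _ => ?_
        rw [hG, pow_succ, ← mul_assoc]
        field_simp
      rw [Finset.sum_range_succ', hs, hf.halfLaplace_eq hh.integrableOn hd hz]
      simp only [Nat.cast_zero, zero_add, pow_zero, div_one]
      push_cast
      ring
    rw [key, norm_mul, pow_succ]
    have := hC z hz
    have hz' : 0 < |z| := abs_pos.2 hz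
    calc _ ≤ ‖(z * Complex.I : ℂ)⁻¹‖ * (C / |z| ^ N) := by gcongr
      _ = C / (|z| ^ N * |z|) := by
        simp
        field_simp

end HalfPowerExpansion

/-- `φ` has the asymptotic expansion `P` in powers of `y` along the filter `l`. -/
def HasAsymptoticSeries {ι : Type*} (l : Filter ι) (y φ : ι → ℂ) (P : PowerSeries ℂ) : Prop :=
  ∀ N : ℕ, (fun i => φ i - ∑ k ∈ Finset.range N, PowerSeries.coeff k P * y i ^ k) =O[l]
    fun i => y i ^ N

namespace HasAsymptoticSeries

variable {ι : Type*} {l : Filter ι} {y φ ψ : ι → ℂ} {P Q : PowerSeries ℂ}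

theorem eval_trunc (P : PowerSeries ℂ) (N : ℕ) (z : ℂ) :
    (P.trunc N).eval z = ∑ k ∈ Finset.range N, PowerSeries.coeff k P * z ^ k := by
  rw [← Polynomial.eval₂_id, PowerSeries.eval₂_trunc_eq_sum_range]
  rfl

theorem isBigO_eval_one (hy : Tendsto y l (𝓝 0)) (p : Polynomial ℂ) :
    (fun i => p.eval (y i)) =O[l] fun _ => (1 : ℂ) :=
  ((p.continuous.tendsto 0).comp hy).isBigO_one ℂ

theorem one : HasAsymptoticSeries l y (fun _ => 1) 1 := by
  intro N
  rcases N with _ | N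
  · simpa using Asymptotics.isBigO_refl (fun _ : ι => (1 : ℂ)) l
  · simpa [Finset.sum_range_succ', PowerSeries.coeff_one] using Asymptotics.isBigO_zero _ l

theorem mul (hy : Tendsto y l (𝓝 0)) (hP : HasAsymptoticSeries l y φ P)
    (hQ : HasAsymptoticSeries l y ψ Q) :
    HasAsymptoticSeries l y (fun i => φ i * ψ i) (P * Q) := by
  intro N
  have hψ : ψ =O[l] fun _ => (1 : ℂ) := by simpa using hQ 0
  have h1 := (hP N).mul hψ
  have h2 := (isBigO_eval_one hy (P.trunc N)).mul (hQ N)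
  obtain ⟨q, hq⟩ : Polynomial.X ^ N ∣ P.trunc N * Q.trunc N - (P * Q).trunc N := by
    rw [Polynomial.X_pow_dvd_iff]
    intro d hd
    rw [Polynomial.coeff_sub, PowerSeries.coeff_trunc, if_pos hd,
      PowerSeries.coeff_mul_eq_coeff_trunc_mul_trunc P Q hd, ← Polynomial.coe_mul,
      Polynomial.coeff_coe, sub_self]
  have h3 : (fun i => (P.trunc N).eval (y i) * (Q.trunc N).eval (y i) -
      ((P * Q).trunc N).eval (y i)) =O[l] fun i => y i ^ N := by
    have := (Asymptotics.isBigO_refl (fun i => y i ^ N) l).mul (isBigO_eval_one hy q)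
    refine (this.congr (fun i => ?_) fun i => by ring)
    rw [← Polynomial.eval_mul, ← Polynomial.eval_sub, hq]
    simp
  simp only [mul_one, one_mul] at h1 h2
  refine ((h1.add h2).add h3).congr_left fun i => ?_
  simp only [eval_trunc]
  ring

theorem prod {κ : Type*} (s : Finset κ) (hy : Tendsto y l (𝓝 0)) {φ : κ → ι → ℂ}
    {P : κ → PowerSeries ℂ} (h : ∀ j, HasAsymptoticSeries l y (φ j) (P j)) :
    HasAsymptoticSeries l y (fun i => ∏ j ∈ s, φ j i) (∏ j ∈ s, P j) := by
  classical
  induction s using Finset.induction_on with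
  | empty => simpa using one
  | insert j s hj ih =>
    simp only [Finset.prod_insert hj]
    exact (h j).mul hy ih

theorem unique [l.NeBot] (hy : Tendsto y l (𝓝 0)) (hy0 : ∀ᶠ i in l, y i ≠ 0)
    (hP : HasAsymptoticSeries l y φ P) (hQ : HasAsymptoticSeries l y φ Q) : P = Q := by
  ext n
  induction n using Nat.strong_induction_on with
  | _ n ih =>
  have h := (hQ (n + 1)).sub (hP (n + 1))
  have h' : (fun i => (PowerSeries.coeff n P - PowerSeries.coeff n Q) * y i ^ n) =O[l]
      fun i => y i ^ (n + 1) := by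
    refine h.congr_left fun i => ?_
    have hs : ∑ k ∈ Finset.range n, PowerSeries.coeff k P * y i ^ k =
        ∑ k ∈ Finset.range n, PowerSeries.coeff k Q * y i ^ k :=
      Finset.sum_congr rfl fun k hk => by rw [ih k (Finset.mem_range.1 hk)]
    rw [Finset.sum_range_succ, Finset.sum_range_succ, hs]
    ring
  have h2 : (fun _ : ι => PowerSeries.coeff n P - PowerSeries.coeff n Q) =O[l] y := by
    refine (h'.mul (Asymptotics.isBigO_refl (fun i => (y i ^ n)⁻¹) l)).congr' ?_ ?_
    · filter_upwards [hy0] with i hi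
      field_simp
    · filter_upwards [hy0] with i hi
      field_simp
      ring
  have h3 := tendsto_nhds_unique tendsto_const_nhds (h2.trans_tendsto hy)
  exact sub_eq_zero.1 h3

end HasAsymptoticSeries

theorem coeff_prod_fin_eq_sum_antidiagonalTuple {d : ℕ} (P : Fin d → PowerSeries ℂ) (n : ℕ) :
    PowerSeries.coeff n (∏ i, P i) =
      ∑ k ∈ Finset.Nat.antidiagonalTuple d n, ∏ i, PowerSeries.coeff (k i) (P i) := by
  rw [PowerSeries.coeff_prod]
  refine Finset.sum_nbij' (fun k => ⇑k) (fun k => Finsupp.equivFunOnFinite.symm k) ?_ ?_ ?_ ?_ ?_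
  · intro k hk
    simpa [Finset.Nat.mem_antidiagonalTuple] using hk
  · intro k hk
    simpa [Finset.Nat.mem_antidiagonalTuple] using hk
  · intro k _
    ext; simp
  · intro k _
    ext; simp
  · intro k _
    rfl

/-- The coefficients of the normalised expansion of the Laplace transform of a function with a
half-power expansion along the ray through `t * I`. -/
noncomputable def rayCoeff (a : ℕ → ℝ) (t : ℝ) : PowerSeries ℂ :=
  PowerSeries.mk fun k => (t * Complex.I) ^ (-(1 / 2) : ℂ) *
    (((a k * Real.Gamma (k + 1 / 2) : ℝ) : ℂ) / (t * Complex.I) ^ k)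

theorem HalfPowerExpansion.hasAsymptoticSeries {f : ℝ → ℝ} {a : ℕ → ℝ} {ε : ℝ}
    (hf : HalfPowerExpansion f a ε) {t : ℝ} (ht : t ≠ 0) {ι : Type*} {l : Filter ι} {m : ι → ℝ}
    (hm : Tendsto m l atTop) :
    HasAsymptoticSeries l (fun i => ((m i)⁻¹ : ℂ))
      (fun i => (√(m i) : ℂ) * halfLaplace f (((m i * t : ℝ) : ℂ) * Complex.I)) (rayCoeff a t) := by
  intro N
  have hmain : (fun i => (√(m i) : ℂ) * halfLaplace f (((m i * t : ℝ) : ℂ) * Complex.I) -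
      ∑ k ∈ Finset.range (N + 1), PowerSeries.coeff k (rayCoeff a t) * ((m i)⁻¹ : ℂ) ^ k) =O[l]
      fun i => ((m i)⁻¹ : ℂ) ^ N := by
    obtain ⟨C, hC⟩ := exists_norm_halfLaplace_sub_le (N + 1) hf
    refine Asymptotics.IsBigO.of_bound (C / |t| ^ (N + 1)) ?_
    filter_upwards [hm.eventually_ge_atTop 1] with i hi
    have hm0 : 0 < m i := by linarith
    have hmt : m i * t ≠ 0 := mul_ne_zero hm0.ne' ht
    have hsq : (√(m i) : ℂ) * (m i : ℂ) ^ (-(1 / 2) : ℂ) = 1 := by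
      rw [Real.sqrt_eq_rpow, Complex.ofReal_cpow hm0.le,
        ← Complex.cpow_add _ _ (by exact_mod_cast hm0.ne')]
      norm_num
    have e : (√(m i) : ℂ) * halfLaplace f (((m i * t : ℝ) : ℂ) * Complex.I) -
        ∑ k ∈ Finset.range (N + 1), PowerSeries.coeff k (rayCoeff a t) * ((m i)⁻¹ : ℂ) ^ k =
        (√(m i) : ℂ) * (halfLaplace f (((m i * t : ℝ) : ℂ) * Complex.I) -
          (((m i * t : ℝ) : ℂ) * Complex.I) ^ (-(1 / 2) : ℂ) * ∑ k ∈ Finset.range (N + 1),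
          ((a k * Real.Gamma (k + 1 / 2) : ℝ) : ℂ) / (((m i * t : ℝ) : ℂ) * Complex.I) ^ k) := by
      rw [mul_sub, Complex.ofReal_mul, mul_assoc (m i : ℂ), ofReal_mul_cpow hm0,
        ← mul_assoc (√(m i) : ℂ) (_ * _), ← mul_assoc (√(m i) : ℂ) (_ ^ _), hsq, one_mul,
        Finset.mul_sum]
      congr 1
      refine Finset.sum_congr rfl fun k _ => ?_
      simp only [rayCoeff, PowerSeries.coeff_mk, mul_pow (m i : ℂ), inv_pow]
      field_simp
    rw [e, norm_mul, Complex.norm_real, Real.norm_of_nonneg (Real.sqrt_nonneg _)]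
    have h1 := hC _ hmt
    have hs : √(m i) ≤ m i := by
      rw [Real.sqrt_le_left hm0.le]; nlinarith
    have ht' : 0 < |t| := abs_pos.2 ht
    calc _ ≤ m i * (C / |m i * t| ^ (N + 1)) := by gcongr
      _ = C / |t| ^ (N + 1) * ‖((m i)⁻¹ : ℂ) ^ N‖ := by
        rw [norm_pow, norm_inv, Complex.norm_real, Real.norm_of_nonneg hm0.le, abs_mul,
          abs_of_pos hm0, mul_pow, inv_pow]
        field_simp
        ring
  have hlast := (Asymptotics.isBigO_refl (fun i => ((m i)⁻¹ : ℂ) ^ N) l).const_mul_left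
    (PowerSeries.coeff N (rayCoeff a t))
  refine (hmain.add hlast).congr_left fun i => ?_
  rw [Finset.sum_range_succ]
  ring

theorem iteratedDeriv_const_mul_comp_mul_left (c s : ℝ) (f : ℝ → ℝ) (n : ℕ) :
    iteratedDeriv n (fun x => c * f (s * x)) =
      fun x => c * s ^ n * iteratedDeriv n f (s * x) := by
  induction n with
  | zero => simp
  | succ n ih =>
    ext x
    rw [iteratedDeriv_succ, ih, deriv_const_mul_field, deriv_comp_mul_left s (iteratedDeriv n f) x,
      iteratedDeriv_succ, smul_eq_mul]
    ring

theorem exists_integrableOn_iteratedDeriv {F : ℝ → ℝ} {t : ℝ} (ht : t ≠ 0)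
    (hcont : ∀ n, ContinuousOn (iteratedDeriv n F) (Ioi 0))
    (h : DecaysFast (rescale t F)) (n : ℕ) :
    ∃ x₁ > 0, IntegrableOn (iteratedDeriv n F) (Ioi x₁) := by
  obtain ⟨x₀, hx₀, H, -, hH, hle⟩ := h n
  have ht' : 0 < |t| := abs_pos.2 ht
  have hr : rescale t F = fun x => 1 / |t| * F (t⁻¹ * x) := by
    ext x; simp [rescale, div_eq_inv_mul]
  have hpos : 0 < x₀ / |t| := by positivity
  have hH' : IntegrableOn (fun x => H (|t| * x)) (Ioi (x₀ / |t|)) := by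
    rw [integrableOn_Ioi_comp_mul_left_iff _ _ ht', mul_div_cancel₀ _ ht'.ne']
    exact hH
  refine ⟨x₀ / |t|, hpos, Integrable.mono' (hH'.const_mul (|t| * |t| ^ n))
    (((hcont n).mono (Ioi_subset_Ioi hpos.le)).aestronglyMeasurable measurableSet_Ioi) ?_⟩
  filter_upwards [ae_restrict_mem measurableSet_Ioi] with x hx
  have hx0 : 0 < x := hpos.trans hx
  have habs : |t * x| = |t| * x := by rw [abs_mul, abs_of_pos hx0]
  have hx' : x₀ < |t * x| := by
    rw [habs, mul_comm]; exact (div_lt_iff₀ ht').1 hx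
  have := hle _ hx'
  rw [hr, iteratedDeriv_const_mul_comp_mul_left] at this
  beta_reduce at this
  rw [inv_mul_cancel_left₀ ht, habs, abs_mul, abs_mul,
    abs_pow, abs_inv, abs_div, abs_one, abs_abs] at this
  rw [Real.norm_eq_abs]
  calc |iteratedDeriv n F x|
      = |t| * |t| ^ n * (1 / |t| * |t|⁻¹ ^ n * |iteratedDeriv n F x|) := by
        rw [inv_pow, one_div]
        field_simp
    _ ≤ _ := by gcongr

theorem HalfPowerExpansion.of_decaysFast {F : ℝ → ℝ} {a : ℕ → ℝ} {ε t : ℝ} (hε : 0 < ε)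
    (ht : t ≠ 0) (hsm : ContDiffOn ℝ (⊤ : ℕ∞) F (Ioi 0))
    (hsum : ∀ x ∈ Ioo (-ε) ε, Summable fun n => a n * x ^ n)
    (hF : ∀ x ∈ Ioo (0:ℝ) ε, F x = x ^ (-(1:ℝ) / 2) * ∑' n, a n * x ^ n)
    (h : DecaysFast (rescale t F)) : HalfPowerExpansion F a ε := by
  have hdiff : ∀ n, ∀ x > 0, DifferentiableAt ℝ (iteratedDeriv n F) x := by
    intro n x hx
    have h1 := hsm.differentiableOn_iteratedDerivWithin (m := n)
      (by exact_mod_cast WithTop.coe_lt_top n) isOpen_Ioi.uniqueDiffOn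
    have h2 := (h1.congr fun y hy => (iteratedDerivWithin_of_isOpen isOpen_Ioi hy).symm)
    exact (h2 x hx).differentiableAt (isOpen_Ioi.mem_nhds hx)
  have hcont : ∀ n, ContinuousOn (iteratedDeriv n F) (Ioi 0) := fun n x hx =>
    (hdiff n x hx).continuousAt.continuousWithinAt
  refine ⟨hε, hsum, hF, fun n => iteratedDeriv n F, iteratedDeriv_zero, ?_, ?_⟩
  · intro n x hx
    beta_reduce
    rw [iteratedDeriv_succ]
    exact (hdiff n x hx).hasDerivAt
  · intro n c hc
    obtain ⟨x₁, hx₁, hi⟩ := exists_integrableOn_iteratedDeriv ht hcont h n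
    have hcpt : IntegrableOn (iteratedDeriv n F) (Icc c x₁) :=
      ((hcont n).mono fun y hy => hc.trans_le hy.1).integrableOn_Icc
    refine (hcpt.union hi).mono_set fun y hy => ?_
    rcases le_or_gt y x₁ with h | h
    · exact Or.inl ⟨le_of_lt hy, h⟩
    · exact Or.inr h

theorem integrable_rescale {F : ℝ → ℝ} (hF : Integrable F) {t : ℝ} (ht : t ≠ 0) :
    Integrable (rescale t F) :=
  (hF.comp_div ht).const_mul _

theorem fourier_rescale {F : ℝ → ℝ} (hsupp : ∀ x ≤ (0 : ℝ), F x = 0) {t : ℝ} (ht : t ≠ 0)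
    (ξ : ℝ) : 𝓕 (fun x => (rescale t F x : ℂ)) ξ =
      halfLaplace F (((2 * Real.pi * ξ * t : ℝ) : ℂ) * Complex.I) := by
  have ht' : |t| ≠ 0 := abs_ne_zero.2 ht
  rw [Real.fourier_real_eq_integral_exp_smul]
  let g : ℝ → ℂ := fun x =>
    (F x : ℂ) * Complex.exp (-(((2 * Real.pi * ξ * t : ℝ) : ℂ) * Complex.I * x))
  have h1 : ∀ x : ℝ, Complex.exp (↑(-2 * Real.pi * x * ξ) * Complex.I) • (rescale t F x : ℂ) =
      ((|t|⁻¹ : ℝ) : ℂ) * g (x / t) := by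
    intro x
    have htc : (t : ℂ) ≠ 0 := by exact_mod_cast ht
    have e : -(((2 * Real.pi * ξ * t : ℝ) : ℂ) * Complex.I * ((x / t : ℝ) : ℂ)) =
        ↑(-2 * Real.pi * x * ξ) * Complex.I := by
      push_cast
      field_simp
    simp only [g, e, rescale, smul_eq_mul]
    push_cast
    ring
  simp only [h1]
  rw [integral_const_mul, Measure.integral_comp_div g t, Complex.real_smul, ← mul_assoc,
    ← Complex.ofReal_mul, inv_mul_cancel₀ ht', Complex.ofReal_one, one_mul, halfLaplace]
  refine (setIntegral_eq_integral_of_forall_compl_eq_zero fun x hx => ?_).symm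
  simp only [g, hsupp x (not_lt.1 hx), Complex.ofReal_zero, zero_mul]

theorem ofReal_conv (f g : ℝ → ℝ) : (fun x => (conv f g x : ℂ)) =
    convolution (fun x => (f x : ℂ)) (fun x => (g x : ℂ)) (ContinuousLinearMap.mul ℂ ℂ) := by
  ext x
  rw [convolution_def, conv, ← integral_complex_ofReal]
  simp

theorem integrable_multiConv : ∀ L : List (ℝ → ℝ), (∀ f ∈ L, Integrable f) →
    Integrable (multiConv L)
  | [], _ => integrable_zero _ _ _
  | [f], h => h f (by simp)
  | f :: g :: L, h => by
    have h1 := h f (by simp)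
    have h2 := integrable_multiConv (g :: L) fun k hk => h k (List.mem_cons_of_mem _ hk)
    exact h1.integrable_convolution (ContinuousLinearMap.mul ℝ ℝ) h2

theorem fourier_multiConv (ξ : ℝ) : ∀ L : List (ℝ → ℝ), L ≠ [] → (∀ f ∈ L, Integrable f) →
    𝓕 (fun x => (multiConv L x : ℂ)) ξ = (L.map fun f : ℝ → ℝ => 𝓕 (fun x : ℝ => (f x : ℂ)) ξ).prod
  | [], h, _ => absurd rfl h
  | [f], _, _ => by simp [multiConv]
  | f :: g :: L, _, h => by
    have h1 := h f (by simp)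
    have hL : ∀ k ∈ g :: L, Integrable k := fun k hk => h k (List.mem_cons_of_mem _ hk)
    have h2 := integrable_multiConv (g :: L) hL
    rw [List.map_cons, List.prod_cons, ← fourier_multiConv ξ (g :: L) (by simp) hL, multiConv,
      ofReal_conv]
    exact Real.fourier_bilin_convolution_eq (ContinuousLinearMap.mul ℂ ℂ) h1.ofReal h2.ofReal ξ

/-- The Fourier transform at an integer is a Fourier coefficient of the periodization. -/
theorem fourier_intCast_eq_integral_tsum {Φ : ℝ → ℝ} (hΦ : Integrable Φ) (n : ℤ) :
    𝓕 (fun x => (Φ x : ℂ)) n = ∫ x in Ioc (-(1 / 2) : ℝ) (1 / 2),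
      Complex.exp (↑(-2 * Real.pi * x * n) * Complex.I) * ((∑' k : ℤ, Φ (x + k) : ℝ) : ℂ) := by
  rw [Real.fourier_real_eq_integral_exp_smul]
  set ψ : ℝ → ℂ := fun x => Complex.exp (↑(-2 * Real.pi * x * n) * Complex.I) • (Φ x : ℂ) with hψ
  have hexp : ∀ x : ℝ, ‖Complex.exp (↑(-2 * Real.pi * x * n) * Complex.I)‖ = 1 := fun x =>
    Complex.norm_exp_ofReal_mul_I _
  have hψi : Integrable ψ := hΦ.ofReal.bdd_mul (c := 1) (by fun_prop)
    (ae_of_all _ fun x => (hexp x).le)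
  have shift : ∀ (E : Type) [NormedAddCommGroup E] [NormedSpace ℝ E] (g : ℝ → E) (k : ℤ),
      ∫ x in (-(1 / 2) + k : ℝ)..(-(1 / 2) + k + 1), g x =
        ∫ x in Ioc (-(1 / 2) : ℝ) (1 / 2), g (x + k) := by
    intro E _ _ g k
    rw [← intervalIntegral.integral_of_le (by norm_num), intervalIntegral.integral_comp_add_right]
    congr 1
    ring
  have hsum := hψi.hasSum_intervalIntegral (-(1 / 2))
  have hsumn := (hψi.norm.hasSum_intervalIntegral (-(1 / 2))).summable
  simp only [shift] at hsum hsumn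
  rw [← hsum.tsum_eq, integral_tsum_of_summable_integral_norm
    (fun k : ℤ => (hψi.comp_add_right (k : ℝ)).integrableOn) hsumn]
  congr 1
  ext x
  rw [Complex.ofReal_tsum, ← tsum_mul_left]
  refine tsum_congr fun k => ?_
  simp only [hψ, smul_eq_mul]
  congr 1
  rw [Complex.exp_eq_exp_iff_exists_int]
  refine ⟨-(n * k), ?_⟩
  push_cast
  ring

theorem coeff_prod_rayCoeff {d : ℕ} (a : ℕ → ℝ) (t : Fin d → ℝ) (n : ℕ) :
    PowerSeries.coeff n (∏ i, rayCoeff a (t i)) =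
      (∏ i, ((t i : ℂ) * Complex.I) ^ (-(1 / 2) : ℂ)) * (Complex.I ^ n)⁻¹ *
        ((∑ k ∈ Finset.Nat.antidiagonalTuple d n,
          ∏ i, a (k i) * Real.Gamma ((k i : ℝ) + 1 / 2) / t i ^ (k i) : ℝ) : ℂ) := by
  rw [coeff_prod_fin_eq_sum_antidiagonalTuple, Complex.ofReal_sum, Finset.mul_sum]
  refine Finset.sum_congr rfl fun k hk => ?_
  rw [← Finset.Nat.mem_antidiagonalTuple.1 hk, ← Finset.prod_pow_eq_pow_sum,
    ← Finset.prod_inv_distrib, Complex.ofReal_prod, ← Finset.prod_mul_distrib, ← Finset.prod_mul_distrib]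
  refine Finset.prod_congr rfl fun i _ => ?_
  rw [rayCoeff, PowerSeries.coeff_mk]
  push_cast
  rw [mul_pow, div_mul_eq_div_div, div_right_comm]
  ring

/-- The coefficient `Aₙ` is, up to a fourth root of unity independent of `n` and explicit factors,
the `n`-th coefficient of the product of the series `rayCoeff`. -/
theorem phase_mul_eq_coeff_prod_rayCoeff {d : ℕ} {a : ℕ → ℝ} {t : Fin d → ℝ} {A : ℕ → ℝ}
    (ht : ∀ i, t i ≠ 0)
    (hA : ∀ n : ℕ, A n = 1 / √|∏ i, t i| * (1 / Real.Gamma ((n : ℝ) + d / 2)) *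
      ∑ k ∈ Finset.Nat.antidiagonalTuple d n,
        ∏ i, a (k i) * Real.Gamma ((k i : ℝ) + 1 / 2) / t i ^ (k i)) (n : ℕ) :
    (∏ i, ((t i : ℂ) * Complex.I) ^ (-(1 / 2) : ℂ)) * (√|∏ i, t i| : ℂ) * A n =
      Complex.I ^ n * (Real.Gamma ((n : ℝ) + d / 2) : ℂ)⁻¹ *
        PowerSeries.coeff n (∏ i, rayCoeff a (t i)) := by
  have hs : (√|∏ i, t i| : ℂ) ≠ 0 := by
    exact_mod_cast (Real.sqrt_pos.2 (abs_pos.2 (Finset.prod_ne_zero_iff.2 fun i _ => ht i))).ne'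
  have hI : Complex.I ^ n ≠ 0 := pow_ne_zero _ Complex.I_ne_zero
  rw [coeff_prod_rayCoeff, hA, Complex.ofReal_mul, Complex.ofReal_mul, Complex.ofReal_div,
    Complex.ofReal_div, Complex.ofReal_one]
  generalize (∏ i, ((t i : ℂ) * Complex.I) ^ (-(1 / 2) : ℂ)) = U
  generalize ((∑ k ∈ Finset.Nat.antidiagonalTuple d n,
    ∏ i, a (k i) * Real.Gamma ((k i : ℝ) + 1 / 2) / t i ^ (k i) : ℝ) : ℂ) = S
  generalize (Real.Gamma ((n : ℝ) + d / 2) : ℂ) = G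
  field_simp

theorem prod_cpow_mul_sqrt_pow_four {d : ℕ} (hd : Even d) {t : Fin d → ℝ} (ht : ∀ i, t i ≠ 0) :
    ((∏ i, ((t i : ℂ) * Complex.I) ^ (-(1 / 2) : ℂ)) * (√|∏ i, t i| : ℂ)) ^ 4 = 1 := by
  have hu : ∀ i, (((t i : ℂ) * Complex.I) ^ (-(1 / 2) : ℂ)) ^ 4 = -((t i : ℂ) ^ 2)⁻¹ := by
    intro i
    rw [← Complex.cpow_nat_mul,
      show ((4 : ℕ) : ℂ) * (-(1 / 2)) = ((-2 : ℤ) : ℂ) by push_cast; ring, Complex.cpow_intCast,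
      zpow_neg, zpow_ofNat, mul_pow, Complex.I_sq]
    simp
  have hs : (√|∏ i, t i|) ^ 4 = ∏ i, t i ^ 2 := by
    rw [show 4 = 2 * 2 by norm_num, pow_mul, Real.sq_sqrt (abs_nonneg _), sq_abs, Finset.prod_pow]
  rw [mul_pow, ← Finset.prod_pow, ← Complex.ofReal_pow, hs, Complex.ofReal_prod]
  simp only [hu, Finset.prod_neg, Finset.card_univ, Fintype.card_fin, hd.neg_one_pow, one_mul]
  rw [← Finset.prod_mul_distrib]
  refine Finset.prod_eq_one fun i _ => ?_
  have : (t i : ℂ) ≠ 0 := by exact_mod_cast ht i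
  push_cast
  field_simp

theorem eq_or_eq_neg_of_mul_eq_mul {w w' : ℂ} (hw : w ^ 4 = 1) (hw' : w' ^ 4 = 1)
    {A A' : ℕ → ℝ} (h : ∀ n, w * A n = w' * A' n) :
    (∀ n, A n = A' n) ∨ (∀ n, A n = -A' n) := by
  have hw0 : w ≠ 0 := by
    rintro rfl
    norm_num at hw
  have hfac : (w - w') * ((w + w') * (w ^ 2 + w' ^ 2)) = 0 := by
    linear_combination hw - hw'
  rcases mul_eq_zero.1 hfac with h1 | h1
  · left
    intro n
    have := h n
    rw [← sub_eq_zero.1 h1] at this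
    exact_mod_cast mul_left_cancel₀ hw0 this
  rcases mul_eq_zero.1 h1 with h2 | h2
  · right
    intro n
    have := h n
    rw [eq_neg_of_add_eq_zero_right h2, neg_mul, ← mul_neg] at this
    exact_mod_cast mul_left_cancel₀ hw0 this
  · left
    intro n
    have hc : w ^ 2 * ((A n : ℂ) ^ 2 + (A' n : ℂ) ^ 2) = 0 := by
      linear_combination (w * A n + w' * A' n) * h n + (A' n : ℂ) ^ 2 * h2
    have hr : A n ^ 2 + A' n ^ 2 = 0 := by
      exact_mod_cast (mul_eq_zero.1 hc).resolve_left (pow_ne_zero 2 hw0)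
    have e1 : A n = 0 := by nlinarith [sq_nonneg (A n), sq_nonneg (A' n)]
    have e2 : A' n = 0 := by nlinarith [sq_nonneg (A n), sq_nonneg (A' n)]
    rw [e1, e2]

theorem multiConv_ofFn_rescale_integrable {d : ℕ} {F : ℝ → ℝ} (hF : Integrable F) {t : Fin d → ℝ}
    (ht : ∀ i, t i ≠ 0) : Integrable (multiConv (List.ofFn fun i => rescale (t i) F)) := by
  refine integrable_multiConv _ fun f hf => ?_
  obtain ⟨i, rfl⟩ := (List.mem_ofFn' _ _).1 hf
  exact integrable_rescale hF (ht i)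

theorem fourier_multiConv_ofFn_rescale {d : ℕ} (hd : d ≠ 0) {F : ℝ → ℝ} (hF : Integrable F)
    (hsupp : ∀ x ≤ (0 : ℝ), F x = 0) {t : Fin d → ℝ} (ht : ∀ i, t i ≠ 0) (ξ : ℝ) :
    𝓕 (fun x : ℝ => (multiConv (List.ofFn fun i => rescale (t i) F) x : ℂ)) ξ =
      ∏ i, halfLaplace F (((2 * Real.pi * ξ * t i : ℝ) : ℂ) * Complex.I) := by
  rw [fourier_multiConv, List.map_ofFn, List.prod_ofFn]
  · exact Finset.prod_congr rfl fun i _ => fourier_rescale hsupp (ht i) ξ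
  · simpa using hd
  · intro f hf
    obtain ⟨i, rfl⟩ := (List.mem_ofFn' _ _).1 hf
    exact integrable_rescale hF (ht i)

theorem HalfPowerExpansion.hasAsymptoticSeries_prod {F : ℝ → ℝ} {a : ℕ → ℝ} {ε : ℝ}
    (hF : HalfPowerExpansion F a ε) {d : ℕ} {t : Fin d → ℝ} (ht : ∀ i, t i ≠ 0) {ι : Type*}
    {l : Filter ι} {m : ι → ℝ} (hm : Tendsto m l atTop) :
    HasAsymptoticSeries l (fun j => ((m j)⁻¹ : ℂ))
      (fun j => (√(m j) : ℂ) ^ d * ∏ i, halfLaplace F (((m j * t i : ℝ) : ℂ) * Complex.I))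
      (∏ i, rayCoeff a (t i)) := by
  have hy : Tendsto (fun j => ((m j)⁻¹ : ℂ)) l (𝓝 0) := by
    have := (Complex.continuous_ofReal.tendsto 0).comp (tendsto_inv_atTop_zero.comp hm)
    simpa [Function.comp_def] using this
  have h := HasAsymptoticSeries.prod Finset.univ hy fun i => hF.hasAsymptoticSeries (ht i) hm
  simpa only [Finset.prod_mul_distrib, Finset.prod_const, Finset.card_univ, Fintype.card_fin]
    using h

theorem fourier_intCast_eq_of_tsum_eq {Φ Ψ : ℝ → ℝ} (hΦ : Integrable Φ) (hΨ : Integrable Ψ)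
    (h : ∀ x ∈ Ioo (-(1 / 2) : ℝ) (1 / 2), x ≠ 0 →
      (∑' k : ℤ, Φ (x + (k : ℝ))) = ∑' k : ℤ, Ψ (x + (k : ℝ))) (n : ℤ) :
    𝓕 (fun x : ℝ => (Φ x : ℂ)) (n : ℝ) = 𝓕 (fun x : ℝ => (Ψ x : ℂ)) (n : ℝ) := by
  rw [fourier_intCast_eq_integral_tsum hΦ, fourier_intCast_eq_integral_tsum hΨ]
  refine setIntegral_congr_ae measurableSet_Ioc ?_
  filter_upwards [compl_mem_ae_iff.2 (measure_singleton (0 : ℝ)),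
    compl_mem_ae_iff.2 (measure_singleton (1 / 2 : ℝ))] with x hx0 hx1 hx
  rw [h x ⟨hx.1, lt_of_le_of_ne hx.2 hx1⟩ hx0]

end

/-- the periodization of `F_{t₁} * ⋯ * F_{t_d}` (for `d` even and
`F(x) = x^{−1/2} ∑ aₙxⁿ` near `0⁺`) determines the sequence `(Aₙ)` up to a global
sign. -/
theorem stmt8 (d : ℕ) (hd2 : 2 ≤ d) (hdeven : Even d)
    (t t' : Fin d → ℝ) (ht : ∀ i, t i ≠ 0) (ht' : ∀ i, t' i ≠ 0)
    (F F' : ℝ → ℝ) (a a' : ℕ → ℝ) (ε : ℝ) (hε : 0 < ε)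
    (hsupp : ∀ x ≤ (0:ℝ), F x = 0) (hsupp' : ∀ x ≤ (0:ℝ), F' x = 0)
    (hint : IntegrableOn F (Ioi 0)) (hint' : IntegrableOn F' (Ioi 0))
    (hsm : ContDiffOn ℝ (⊤ : ℕ∞) F (Ioi 0)) (hsm' : ContDiffOn ℝ (⊤ : ℕ∞) F' (Ioi 0))
    (hsum : ∀ x ∈ Ioo (-ε) ε, Summable fun n => a n * x ^ n)
    (hsum' : ∀ x ∈ Ioo (-ε) ε, Summable fun n => a' n * x ^ n)
    (hF : ∀ x ∈ Ioo (0:ℝ) ε, F x = x ^ (-(1:ℝ) / 2) * ∑' n, a n * x ^ n)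
    (hF' : ∀ x ∈ Ioo (0:ℝ) ε, F' x = x ^ (-(1:ℝ) / 2) * ∑' n, a' n * x ^ n)
    (hsub : ∀ s : Finset (Fin d), s.Nonempty →
      ((∀ i ∈ s, 0 < t i) ∨ (∀ i ∈ s, t i < 0)) →
      DecaysFast (multiConv (s.toList.map fun i => rescale (t i) F)))
    (hsub' : ∀ s : Finset (Fin d), s.Nonempty →
      ((∀ i ∈ s, 0 < t' i) ∨ (∀ i ∈ s, t' i < 0)) →
      DecaysFast (multiConv (s.toList.map fun i => rescale (t' i) F')))
    (hfull : DecaysFast (multiConv (List.ofFn fun i => rescale (t i) F)))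
    (hfull' : DecaysFast (multiConv (List.ofFn fun i => rescale (t' i) F')))
    (A A' : ℕ → ℝ)
    (hA : ∀ n : ℕ, A n = 1 / Real.sqrt |∏ i, t i| * (1 / Real.Gamma ((n : ℝ) + d / 2)) *
      ∑ k ∈ Finset.Nat.antidiagonalTuple d n,
        ∏ i, a (k i) * Real.Gamma ((k i : ℝ) + 1 / 2) / t i ^ (k i))
    (hA' : ∀ n : ℕ, A' n = 1 / Real.sqrt |∏ i, t' i| * (1 / Real.Gamma ((n : ℝ) + d / 2)) *
      ∑ k ∈ Finset.Nat.antidiagonalTuple d n,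
        ∏ i, a' (k i) * Real.Gamma ((k i : ℝ) + 1 / 2) / t' i ^ (k i))
    (heq : ∀ x ∈ Ioo (-(1/2) : ℝ) (1/2), x ≠ 0 →
      (∑' k : ℤ, multiConv (List.ofFn fun i => rescale (t i) F) (x + (k : ℝ))) =
        ∑' k : ℤ, multiConv (List.ofFn fun i => rescale (t' i) F') (x + (k : ℝ))) :
    (∀ n, A n = A' n) ∨ (∀ n, A n = -A' n) := by
  have hd : d ≠ 0 := by omega
  let i₀ : Fin d := ⟨0, by omega⟩
  have hdecay : DecaysFast (rescale (t i₀) F) := by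
    simpa [multiConv] using hsub {i₀} (Finset.singleton_nonempty _)
      (by simpa using (ht i₀).lt_or_gt.symm)
  have hdecay' : DecaysFast (rescale (t' i₀) F') := by
    simpa [multiConv] using hsub' {i₀} (Finset.singleton_nonempty _)
      (by simpa using (ht' i₀).lt_or_gt.symm)
  have hexp : HalfPowerExpansion F a ε :=
    .of_decaysFast hε (ht _) hsm hsum hF hdecay
  have hexp' : HalfPowerExpansion F' a' ε :=
    .of_decaysFast hε (ht' _) hsm' hsum' hF' hdecay'
  have hFi : Integrable F := (integrableOn_iff_integrable_of_support_subset
    fun x hx => not_le.1 fun h => hx (hsupp x h)).1 hint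
  have hFi' : Integrable F' := (integrableOn_iff_integrable_of_support_subset
    fun x hx => not_le.1 fun h => hx (hsupp' x h)).1 hint'
  have hfour : ∀ n : ℕ, ∏ i, halfLaplace F (((2 * Real.pi * n * t i : ℝ) : ℂ) * Complex.I) =
      ∏ i, halfLaplace F' (((2 * Real.pi * n * t' i : ℝ) : ℂ) * Complex.I) := by
    intro n
    rw [← fourier_multiConv_ofFn_rescale hd hFi hsupp ht,
      ← fourier_multiConv_ofFn_rescale hd hFi' hsupp' ht']
    exact_mod_cast fourier_intCast_eq_of_tsum_eq (multiConv_ofFn_rescale_integrable hFi ht)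
      (multiConv_ofFn_rescale_integrable hFi' ht') heq n
  have hm : Filter.Tendsto (fun n : ℕ => 2 * Real.pi * (n : ℝ)) Filter.atTop Filter.atTop :=
    tendsto_natCast_atTop_atTop.const_mul_atTop (by positivity)
  have hprod : ∏ i, rayCoeff a (t i) = ∏ i, rayCoeff a' (t' i) := by
    have h1 := hexp.hasAsymptoticSeries_prod ht hm
    have h2 := hexp'.hasAsymptoticSeries_prod ht' hm
    simp only [← hfour] at h2
    refine h1.unique ?_ ?_ h2
    · have := (Complex.continuous_ofReal.tendsto 0).comp (tendsto_inv_atTop_zero.comp hm)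
      simpa [Function.comp_def] using this
    · filter_upwards [hm.eventually_gt_atTop 0] with n hn
      exact inv_ne_zero (by exact_mod_cast hn.ne')
  refine eq_or_eq_neg_of_mul_eq_mul (prod_cpow_mul_sqrt_pow_four hdeven ht)
    (prod_cpow_mul_sqrt_pow_four hdeven ht') fun n => ?_
  rw [phase_mul_eq_coeff_prod_rayCoeff ht hA, phase_mul_eq_coeff_prod_rayCoeff ht' hA', hprod]
end
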